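/- arXiv:1809.10371 — 2 statements merged into one kernel-verified Lean document; each statement's English description precedes it below -/
import Mathlib

section
/- Let Ω ⊆ ℂ^m_t × ℂ^n_z be a pseudoconvex domain, p : Ω → ℂ^m the natural projection, Ω_t = p^{-1}(t), and φ a plurisubharmonic function on Ω. For each integer k ≥ 1, let K_k(t,z) denote the k-Bergman kernel of the fiber Ω_t with weight e^{-φ(t,·)}. Then the relative k-Bergman kernel (t,z) ↦ K_k(t,z) is upper semicontinuous on Ω. -/
open MeasureTheory Complex Set
open scoped ENNReal NNReal

noncomputable section

/-- `e^x` as a map `EReal → ℝ≥0∞` (`e^{-∞} = 0`, `e^{+∞} = ∞`). -/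
def expE (x : EReal) : ℝ≥0∞ := EReal.exp x

/-- `log` as a map `ℝ≥0∞ → EReal`. -/
def logE (x : ℝ≥0∞) : EReal := ENNReal.log x

/-- Truncation of an extended real to `ℝ≥0∞`. -/
def toENN (x : EReal) : ℝ≥0∞ := if x = ⊤ then ⊤ else ENNReal.ofReal x.toReal

/-- The point `c + r·e^{iθ}` on the circle of center `c` and radius `r`. -/
def cpt (c : ℂ) (r θ : ℝ) : ℂ := c + r * Complex.exp (θ * Complex.I)

/-- The averaged "deficit" `M - (circle mean of u)` over the circle of center `c`, radius `r`,
for an upper bound `M` of `u` on that circle. -/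
def circleDeficit (u : ℂ → EReal) (c : ℂ) (r M : ℝ) : ℝ≥0∞ :=
  (∫⁻ θ in Set.Ioc 0 (2 * Real.pi), toENN ((M : EReal) - u (cpt c r θ))) /
    ENNReal.ofReal (2 * Real.pi)

/-- Sub-mean value inequality for `u` at the circle of center `c` and radius `r`:
`u c ≤ (circle mean of u)`, expressed as `u c + (M - mean) ≤ M` for every
upper bound `M` of `u` on the circle. -/
def SubmeanAt (u : ℂ → EReal) (c : ℂ) (r : ℝ) : Prop :=
  ∀ M : ℝ, (∀ θ : ℝ, u (cpt c r θ) ≤ (M : EReal)) →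
    u c + ((circleDeficit u c r M : ℝ≥0∞) : EReal) ≤ (M : EReal)

/-- A function `u : ℂ → EReal` is subharmonic on a set `S` if it is upper semicontinuous on `S`
and satisfies the sub-mean value inequality on every closed disc contained in `S`. -/
def SubharmonicOn (u : ℂ → EReal) (S : Set ℂ) : Prop :=
  UpperSemicontinuousOn u S ∧
    ∀ c r, 0 < r → Metric.closedBall c r ⊆ S → SubmeanAt u c r

/-- A function with values in `[-∞, +∞)` is plurisubharmonic on `D` if it is upper
semicontinuous on `D` and its restriction to every complex line is subharmonic. -/
def PlurisubharmonicOn {E : Type*} [NormedAddCommGroup E] [NormedSpace ℂ E]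
    (φ : E → EReal) (D : Set E) : Prop :=
  UpperSemicontinuousOn φ D ∧
    ∀ a b : E, SubharmonicOn (fun w : ℂ => φ (a + w • b)) {w : ℂ | a + w • b ∈ D}

/-- A set is a pseudoconvex domain if it is open, connected and admits a continuous
plurisubharmonic exhaustion function. -/
def IsPseudoconvexDomain {E : Type*} [NormedAddCommGroup E] [NormedSpace ℂ E]
    (Ω : Set E) : Prop :=
  IsOpen Ω ∧ IsConnected Ω ∧
    ∃ ρ : E → ℝ, ContinuousOn ρ Ω ∧ PlurisubharmonicOn (fun z => (ρ z : EReal)) Ω ∧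
      ∀ c : ℝ, IsCompact {z ∈ Ω | ρ z ≤ c}

/-- The `m`-norm `‖u‖_m = (∫_Ω |u|^{2/m} e^{-φ/m} dλ)^{m/2}` of the weighted `m`-Bergman space. -/
def mNorm {E : Type*} [NormedAddCommGroup E] [NormedSpace ℂ E] [MeasureSpace E]
    (Ω : Set E) (φ : E → EReal) (m : ℕ) (u : E → ℂ) : ℝ≥0∞ :=
  (∫⁻ z in Ω, (‖u z‖₊ : ℝ≥0∞) ^ (2 / (m : ℝ)) * expE (-(φ z) * (((m : ℝ)⁻¹ : ℝ) : EReal))) ^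
    ((m : ℝ) / 2)

/-- The `m`-Bergman kernel `K_m(x) = sup { |u(x)|² / ‖u‖_m² : u ∈ H_m(Ω,φ) }` (with the
convention `0/0 = 0`, so that `K_m(x) = 0` if every `u ∈ H_m(Ω,φ)` vanishes at `x`). -/
def mBergmanKernel {E : Type*} [NormedAddCommGroup E] [NormedSpace ℂ E] [MeasureSpace E]
    (Ω : Set E) (φ : E → EReal) (m : ℕ) (x : E) : ℝ≥0∞ :=
  ⨆ u ∈ {u : E → ℂ | DifferentiableOn ℂ u Ω ∧ mNorm Ω φ m u < ⊤},
    ((‖u x‖₊ : ℝ≥0∞) ^ 2) / (mNorm Ω φ m u) ^ 2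


open Filter Topology Metric

theorem mtl_lip {E : Type*} [NormedAddCommGroup E] [NormedSpace ℂ E] {f : E → ℂ} {x y : E}
    {s M : ℝ} (hd : DifferentiableOn ℂ f (ball x s))
    (hM : ∀ z ∈ ball x s, ‖f z‖ ≤ M) (hy : y ∈ ball x s) :
    dist (f y) (f x) ≤ (2 * M) / s * dist y x := by
  refine Complex.dist_le_div_mul_dist_of_mapsTo_ball hd (fun z hz => ?_) hy
  have hx : x ∈ ball x s := mem_ball_self (pos_of_mem_ball hy)
  rw [mem_closedBall, dist_eq_norm]
  calc ‖f z - f x‖ ≤ ‖f z‖ + ‖f x‖ := norm_sub_le _ _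
    _ ≤ 2 * M := by linarith [hM z hz, hM x hx]

theorem mtl_fderiv {E : Type*} [NormedAddCommGroup E] [NormedSpace ℂ E] {f : E → ℂ} {x : E}
    {s M : ℝ} (hs : 0 < s) (hd : DifferentiableOn ℂ f (ball x s))
    (hM : ∀ z ∈ ball x s, ‖f z‖ ≤ M) : ‖fderiv ℂ f x‖ ≤ (2 * M) / s := by
  refine Complex.norm_fderiv_le_div_of_mapsTo_ball hd (fun z hz => ?_) hs
  have hx : x ∈ ball x s := mem_ball_self hs
  rw [mem_closedBall, dist_eq_norm]
  calc ‖f z - f x‖ ≤ ‖f z‖ + ‖f x‖ := norm_sub_le _ _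
    _ ≤ 2 * M := by linarith [hM z hz, hM x hx]

/-- Uniform Cauchy on small balls from convergence on a dense sequence. -/
theorem mtl_cauchy {E : Type*} [NormedAddCommGroup E] [NormedSpace ℂ E] [ProperSpace E]
    {u : ℕ → E → ℂ} {D : ℕ → E} (hD : DenseRange D) {a : E} {r M : ℝ} (hr : 0 < r)
    (h : ∀ᶠ j in atTop, DifferentiableOn ℂ (u j) (ball a r) ∧ ∀ z ∈ ball a r, ‖u j z‖ ≤ M)
    (hc : ∀ i, D i ∈ ball a r → CauchySeq (fun j => u j (D i))) :
    UniformCauchySeqOn u atTop (ball a (r / 4)) := by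
  rw [Metric.uniformCauchySeqOn_iff]
  intro ε hε
  have hM : 0 ≤ M := by
    obtain ⟨j, hj⟩ := h.exists
    exact (norm_nonneg _).trans (hj.2 a (mem_ball_self hr))
  set L := 2 * M / (r / 2) with hL
  have hL0 : 0 ≤ L := by positivity
  set δ := min (r / 4) (ε / (3 * (L + 1))) with hδ
  have hδ0 : 0 < δ := by positivity
  have hcov : closedBall a (r / 4) ⊆ ⋃ i ∈ {i | D i ∈ ball a (r / 2)}, ball (D i) δ := by
    intro z hz
    obtain ⟨i, hi⟩ := hD.exists_dist_lt z hδ0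
    simp only [mem_iUnion, mem_ofPred_eq]
    refine ⟨i, ?_, hi⟩
    rw [mem_ball]
    have h1 : dist z a ≤ r / 4 := hz
    have h2 : δ ≤ r / 4 := min_le_left _ _
    calc dist (D i) a ≤ dist (D i) z + dist z a := dist_triangle _ _ _
      _ < r / 2 := by rw [dist_comm (D i)]; linarith
  obtain ⟨b, hbs, hbf, hb⟩ := (isCompact_closedBall a (r / 4)).elim_finite_subcover_image
    (fun i _ => isOpen_ball) hcov
  have hev : ∀ᶠ N in atTop, ∀ i ∈ b, ∀ p ≥ N, ∀ q ≥ N, dist (u p (D i)) (u q (D i)) < ε / 3 := by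
    rw [hbf.eventually_all]
    intro i hi
    have hmem : D i ∈ ball a r := ball_subset_ball (by linarith) (hbs hi)
    obtain ⟨N, hN⟩ := Metric.cauchySeq_iff.1 (hc i hmem) (ε / 3) (by positivity)
    filter_upwards [eventually_ge_atTop N] with K hK p hp q hq
    exact hN p (hK.trans hp) q (hK.trans hq)
  obtain ⟨N₁, hN₁⟩ := eventually_atTop.1 h
  obtain ⟨N, hN, hN'⟩ := (hev.and (eventually_ge_atTop N₁)).exists
  refine ⟨N, fun p hp q hq z hz => ?_⟩
  have hz' := hb (ball_subset_closedBall hz)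
  simp only [mem_iUnion] at hz'
  obtain ⟨i, hi, hzi⟩ := hz'
  have key : ∀ j ≥ N, dist (u j z) (u j (D i)) < ε / 3 := by
    intro j hj
    obtain ⟨h1, h2⟩ := hN₁ j (hN'.trans hj)
    have hsub : ball (D i) (r / 2) ⊆ ball a r := by
      apply ball_subset_ball'
      have := mem_ball.1 (hbs hi)
      linarith
    have h3 : δ ≤ r / 4 := min_le_left _ _
    have h4 : δ ≤ ε / (3 * (L + 1)) := min_le_right _ _
    have := mtl_lip (h1.mono hsub) (fun z hz => h2 z (hsub hz))
      (ball_subset_ball (by linarith) hzi : z ∈ ball (D i) (r / 2))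
    refine this.trans_lt ?_
    rw [← hL]
    have h5 : dist z (D i) < ε / (3 * (L + 1)) := (mem_ball.1 hzi).trans_le h4
    calc L * dist z (D i) ≤ L * (ε / (3 * (L + 1))) := by gcongr
      _ < (L + 1) * (ε / (3 * (L + 1))) := by gcongr; linarith
      _ = ε / 3 := by field_simp
  have e1 := key p hp
  have e2 := key q hq
  have e3 := hN i hi p hp q hq
  calc dist (u p z) (u q z) ≤ dist (u p z) (u p (D i)) + dist (u p (D i)) (u q (D i))
        + dist (u q (D i)) (u q z) := dist_triangle4 _ _ _ _
    _ < ε := by rw [dist_comm (u q (D i))]; linarith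

theorem mtl_diff {E : Type*} [NormedAddCommGroup E] [NormedSpace ℂ E]
    {u : ℕ → E → ℂ} {g : E → ℂ} {a : E} {r : ℝ} (hr : 0 < r)
    (h : ∀ᶠ j in atTop, DifferentiableOn ℂ (u j) (ball a r))
    (hc : TendstoUniformlyOn u g atTop (ball a r)) : DifferentiableAt ℂ g a := by
  have hC := hc.uniformCauchySeqOn
  have hsub : ∀ x ∈ ball a (r / 2), ball x (r / 2) ⊆ ball a r := by
    intro x hx
    apply ball_subset_ball'
    have := mem_ball.1 hx
    linarith
  have hF : UniformCauchySeqOn (fun j => fderiv ℂ (u j)) atTop (ball a (r / 2)) := by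
    rw [Metric.uniformCauchySeqOn_iff] at hC ⊢
    intro ε hε
    obtain ⟨N, hN⟩ := hC (ε * r / 8) (by positivity)
    obtain ⟨N₁, hN₁⟩ := eventually_atTop.1 h
    refine ⟨max N N₁, fun p hp q hq x hx => ?_⟩
    have dp := hN₁ p ((le_max_right _ _).trans hp)
    have dq := hN₁ q ((le_max_right _ _).trans hq)
    have hxa : x ∈ ball a r := ball_subset_ball (by linarith) hx
    have n1 : ball a r ∈ 𝓝 x := isOpen_ball.mem_nhds hxa
    rw [dist_eq_norm, ← fderiv_sub (dp.differentiableAt n1) (dq.differentiableAt n1)]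
    have := mtl_fderiv (f := u p - u q) (x := x) (s := r / 2) (M := ε * r / 8) (by linarith)
      ((dp.sub dq).mono (hsub x hx)) (fun z hz => by
        have := hN p ((le_max_left _ _).trans hp) q ((le_max_left _ _).trans hq) z (hsub x hx hz)
        rw [dist_eq_norm] at this
        exact this.le)
    refine this.trans_lt ?_
    have : 2 * (ε * r / 8) / (r / 2) = ε / 2 := by field_simp; norm_num
    rw [this]; linarith
  have hlim : ∀ x ∈ ball a (r / 2), ∃ l, Tendsto (fun j => fderiv ℂ (u j) x) atTop (𝓝 l) :=
    fun x hx => cauchySeq_tendsto_of_complete (hF.cauchySeq hx)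
  choose! G hG using hlim
  have hT := hF.tendstoUniformlyOn_of_tendsto hG
  have hn : ball a (r / 2) ∈ 𝓝 a := ball_mem_nhds _ (by linarith)
  have := hasFDerivAt_of_tendstoUniformlyOnFilter (𝕜 := ℂ) (l := atTop) (f := u)
    (f' := fun j => fderiv ℂ (u j)) (g := g) (g' := G) (x := a)
    ((tendstoUniformlyOn_iff_tendstoUniformlyOnFilter.1 hT).mono_right (le_principal_iff.2 hn))
    (by
      filter_upwards [h.prod_mk (ball_mem_nhds a hr : ∀ᶠ x in 𝓝 a, x ∈ ball a r)] with p hp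
      exact (hp.1.differentiableAt (isOpen_ball.mem_nhds hp.2)).hasFDerivAt)
    (by
      filter_upwards [ball_mem_nhds a hr] with y hy
      exact hc.tendsto_at hy)
  exact this.differentiableAt

/-- Montel's theorem for sequences of functions holomorphic on varying domains. -/
theorem mtl {E : Type*} [NormedAddCommGroup E] [NormedSpace ℂ E] [ProperSpace E]
    {u : ℕ → E → ℂ} {U : Set E}
    (h : ∀ a ∈ U, ∃ r > 0, ∃ M : ℝ, ball a r ⊆ U ∧
      ∀ᶠ j in atTop, DifferentiableOn ℂ (u j) (ball a r) ∧ ∀ z ∈ ball a r, ‖u j z‖ ≤ M) :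
    ∃ σ : ℕ → ℕ, StrictMono σ ∧ ∃ g : E → ℂ, DifferentiableOn ℂ g U ∧
      ∀ a ∈ U, ∃ r > 0, TendstoUniformlyOn (fun j => u (σ j)) g atTop (ball a r) := by
  classical
  set D : ℕ → E := TopologicalSpace.denseSeq E with hDdef
  have hD : DenseRange D := TopologicalSpace.denseRange_denseSeq E
  let x : ℕ → ℕ → ℂ := fun j i => if D i ∈ U then u j (D i) else 0
  have hb : ∀ i, ∃ B : ℝ, ∀ j, ‖x j i‖ ≤ B := by
    intro i
    by_cases hi : D i ∈ U
    · obtain ⟨r, hr, M, -, hM⟩ := h _ hi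
      have h1 : IsBoundedUnder (· ≤ ·) atTop (fun j => ‖x j i‖) := by
        refine ⟨M, ?_⟩
        rw [eventually_map]
        filter_upwards [hM] with j hj
        simp only [x, hi, if_true]
        exact hj.2 _ (mem_ball_self hr)
      obtain ⟨B, hB⟩ := h1.bddAbove_range
      exact ⟨B, fun j => hB ⟨j, rfl⟩⟩
    · exact ⟨0, fun j => by simp [x, hi]⟩
  choose B hB using hb
  have hK : IsCompact (Set.univ.pi fun i => closedBall (0 : ℂ) (B i)) :=
    isCompact_univ_pi fun i => isCompact_closedBall _ _
  obtain ⟨l, -, σ, hσ, hl⟩ := hK.tendsto_subseq (x := x) (fun j i _ => by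
    simpa using hB i j)
  have hconv : ∀ i, D i ∈ U → CauchySeq (fun j => u (σ j) (D i)) := by
    intro i hi
    have := (tendsto_pi_nhds.1 hl i).cauchySeq
    simpa [x, hi, Function.comp_def] using this
  have hloc : ∀ a ∈ U, ∃ r > 0, (∀ᶠ j in atTop, DifferentiableOn ℂ (u (σ j)) (ball a r)) ∧
      ball a r ⊆ U ∧ UniformCauchySeqOn (fun j => u (σ j)) atTop (ball a r) := by
    intro a ha
    obtain ⟨r, hr, M, hU, hM⟩ := h a ha
    have hs : ball a (r / 4) ⊆ ball a r := ball_subset_ball (by linarith)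
    have hM' := hσ.tendsto_atTop.eventually hM
    exact ⟨r / 4, by linarith, hM'.mono fun j hj => hj.1.mono hs, hs.trans hU,
      mtl_cauchy hD hr hM' fun i hi => hconv i (hU hi)⟩
  have hlim : ∀ z ∈ U, ∃ w, Tendsto (fun j => u (σ j) z) atTop (𝓝 w) := by
    intro z hz
    obtain ⟨r, hr, -, -, hC⟩ := hloc z hz
    exact cauchySeq_tendsto_of_complete (hC.cauchySeq (mem_ball_self hr))
  choose! g hg using hlim
  have hT : ∀ a ∈ U, ∃ r > 0, (∀ᶠ j in atTop, DifferentiableOn ℂ (u (σ j)) (ball a r)) ∧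
      TendstoUniformlyOn (fun j => u (σ j)) g atTop (ball a r) := by
    intro a ha
    obtain ⟨r, hr, hd, hU, hC⟩ := hloc a ha
    exact ⟨r, hr, hd, hC.tendstoUniformlyOn_of_tendsto fun z hz => hg z (hU hz)⟩
  refine ⟨σ, hσ, g, fun a ha => ?_, fun a ha => ?_⟩
  · obtain ⟨r, hr, hd, hT⟩ := hT a ha
    exact (mtl_diff hr hd hT).differentiableWithinAt
  · obtain ⟨r, hr, -, hT⟩ := hT a ha
    exact ⟨r, hr, hT⟩

theorem rot_preserving {n : ℕ} (θ : ℝ) :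
    MeasurePreserving (fun v : Fin n → ℂ => circleMap 0 1 θ • v) := by
  have h1 : MeasurePreserving (fun w : ℂ => circleMap 0 1 θ * w) := by
    have := (rotation ⟨circleMap 0 1 θ, by simp [Submonoid.unitSphere]⟩ :
      ℂ ≃ₗᵢ[ℝ] ℂ).measurePreserving
    convert this using 1
    ext w
    rfl
  exact volume_preserving_pi (fun _ : Fin n => h1)

theorem meas_ind {E F : Type*} [TopologicalSpace E] [MeasurableSpace E] [BorelSpace E]
    [TopologicalSpace F] [MeasurableSpace F] [BorelSpace F] [Zero F]
    {s : Set E} (hs : IsOpen s) {g : E → F} (hg : ContinuousOn g s) :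
    Measurable (s.indicator g) := by
  classical
  rw [← Set.piecewise_eq_indicator]
  exact hg.measurable_piecewise continuousOn_const hs.measurableSet

theorem circ_mv {g : ℂ → ℂ} (hg : DifferentiableOn ℂ g (closedBall 0 1)) :
    ‖g 0‖ₑ * ENNReal.ofReal (2 * Real.pi) ≤
      ∫⁻ θ in Set.Ioc 0 (2 * Real.pi), ‖g (circleMap 0 1 θ)‖ₑ := by
  have hd : DiffContOnCl ℂ g (ball 0 |1|) := by
    apply DifferentiableOn.diffContOnCl
    rw [abs_one, closure_ball _ one_ne_zero]
    exact hg
  have h := hd.circleAverage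
  rw [Real.circleAverage_def, intervalIntegral.integral_of_le Real.two_pi_pos.le] at h
  rw [← h, enorm_smul]
  have : ‖(2 * Real.pi)⁻¹‖ₑ * ENNReal.ofReal (2 * Real.pi) = 1 := by
    rw [Real.enorm_of_nonneg (by positivity), ← ENNReal.ofReal_mul (by positivity),
      inv_mul_cancel₀ (by positivity), ENNReal.ofReal_one]
  rw [mul_right_comm, this, one_mul]
  exact enorm_integral_le_lintegral_enorm _

theorem ball_mv {n : ℕ} {f : (Fin n → ℂ) → ℂ} {c : Fin n → ℂ} {s : ℝ}
    (hf : DifferentiableOn ℂ f (ball c s)) :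
    ‖f c‖ₑ * volume (ball c s) ≤ ∫⁻ v in ball c s, ‖f v‖ₑ := by
  set h : (Fin n → ℂ) → ℝ≥0∞ := (ball 0 s).indicator (fun v => ‖f (c + v)‖ₑ) with hh
  have hmaps : MapsTo (fun v => c + v) (ball 0 s) (ball c s) := by
    intro v hv
    simpa using hv
  have hmeas : Measurable h := by
    apply meas_ind isOpen_ball
    refine continuous_enorm.comp_continuousOn ?_
    exact hf.continuousOn.comp (by fun_prop) hmaps
  have e1 : ∫⁻ v in ball c s, ‖f v‖ₑ = ∫⁻ v, h v := by
    rw [← lintegral_indicator isOpen_ball.measurableSet,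
      ← lintegral_add_left_eq_self _ c]
    congr 1
    ext v
    simp only [hh, Set.indicator]
    simp
  have e2 : volume (ball c s) = volume (ball (0 : Fin n → ℂ) s) := by
    rw [Measure.addHaar_ball_center]
  have e3 : ∀ v ∈ ball (0 : Fin n → ℂ) s, ‖f c‖ₑ * ENNReal.ofReal (2 * Real.pi) ≤
      ∫⁻ θ in Set.Ioc 0 (2 * Real.pi), h (circleMap 0 1 θ • v) := by
    intro v hv
    have hm : ∀ w : ℂ, ‖w‖ ≤ 1 → w • v ∈ ball (0 : Fin n → ℂ) s := by
      intro w hw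
      rw [mem_ball_zero_iff] at hv ⊢
      rw [norm_smul]
      nlinarith [norm_nonneg v]
    have := circ_mv (g := fun w => f (c + w • v)) (by
      refine hf.comp (by fun_prop) ?_
      intro w hw
      exact hmaps (hm w (by simpa using hw)))
    simp only [zero_smul, add_zero] at this
    refine this.trans_eq ?_
    congr 1
    ext θ
    rw [hh, Set.indicator_of_mem (hm _ (by simp))]
  have h2pi : ENNReal.ofReal (2 * Real.pi) ≠ 0 := by
    simp [Real.pi_pos]
  rw [e1, e2]
  rw [← ENNReal.mul_le_mul_iff_left h2pi ENNReal.ofReal_ne_top]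
  calc ‖f c‖ₑ * volume (ball (0 : Fin n → ℂ) s) * ENNReal.ofReal (2 * Real.pi)
      = ∫⁻ v in ball (0 : Fin n → ℂ) s, ‖f c‖ₑ * ENNReal.ofReal (2 * Real.pi) := by
        rw [setLIntegral_const]; ring
    _ ≤ ∫⁻ v in ball (0 : Fin n → ℂ) s, ∫⁻ θ in Set.Ioc 0 (2 * Real.pi),
          h (circleMap 0 1 θ • v) := setLIntegral_mono' isOpen_ball.measurableSet e3
    _ ≤ ∫⁻ v, ∫⁻ θ in Set.Ioc 0 (2 * Real.pi), h (circleMap 0 1 θ • v) :=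
        setLIntegral_le_lintegral _ _
    _ = ∫⁻ θ in Set.Ioc 0 (2 * Real.pi), ∫⁻ v, h (circleMap 0 1 θ • v) := by
        rw [lintegral_lintegral_swap]
        refine (hmeas.comp ?_).aemeasurable
        apply Continuous.measurable
        have := continuous_circleMap 0 1
        fun_prop
    _ = ∫⁻ θ in Set.Ioc 0 (2 * Real.pi), ∫⁻ v, h v := by
        congr 1
        ext θ
        exact (rot_preserving θ).lintegral_comp hmeas
    _ = (∫⁻ v, h v) * ENNReal.ofReal (2 * Real.pi) := by
        rw [setLIntegral_const, Real.volume_Ioc, sub_zero]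

theorem sup_bound (n k : ℕ) (hk : 1 ≤ k) {R : ℝ} (hR : 0 < R) :
    ∃ C : ℝ, 0 < C ∧ ∀ (f : (Fin n → ℂ) → ℂ) (a : Fin n → ℂ), DifferentiableOn ℂ f (ball a R) →
      ∀ z ∈ ball a (R / 4), ENNReal.ofReal (‖f z‖ ^ (2 / (k : ℝ))) ≤
        ENNReal.ofReal C * ∫⁻ w in ball a R, (‖f w‖₊ : ℝ≥0∞) ^ (2 / (k : ℝ)) := by
  have hk0 : (0 : ℝ) < k := by exact_mod_cast hk
  set p : ℝ := 2 / (k : ℝ) with hp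
  have hp0 : 0 < p := by positivity
  have hp2 : 0 ≤ 2 - p := by
    have : p ≤ 2 := by
      rw [hp, div_le_iff₀ hk0]
      have : (1 : ℝ) ≤ k := by exact_mod_cast hk
      linarith
    linarith
  set D := Module.finrank ℝ (Fin n → ℂ) with hD
  set N := (D + 1) * k with hN
  have hN0 : N ≠ 0 := by positivity
  set V1 := (volume (ball (0 : Fin n → ℂ) 1)).toReal with hV1
  have hV1t : volume (ball (0 : Fin n → ℂ) 1) ≠ ⊤ := measure_ball_lt_top.ne
  have hV10 : 0 < V1 := ENNReal.toReal_pos (measure_ball_pos _ _ one_pos).ne' hV1t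
  set ρ := R / 2 with hρ
  have hρ0 : 0 < ρ := by positivity
  set B : ℝ := ((2 : ℝ) ^ N) ^ (2 - p) with hB
  have hB0 : 0 < B := by positivity
  refine ⟨2 ^ D * ρ ^ (D + 2) * B / (V1 * (R / 4) ^ (2 * (D + 1))), by positivity, ?_⟩
  intro f a hf z hz
  set I := ∫⁻ w in ball a R, (‖f w‖₊ : ℝ≥0∞) ^ p with hI
  by_cases hIt : I = ⊤
  · rw [hIt, ENNReal.mul_top]
    · exact le_top
    · rw [Ne, ENNReal.ofReal_eq_zero, not_le]; positivity
  rw [← ENNReal.ofReal_toReal hIt, ← ENNReal.ofReal_mul (by positivity)]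
  apply ENNReal.ofReal_le_ofReal
  -- maximum point
  have hsubR : closedBall a ρ ⊆ ball a R := closedBall_subset_ball (by rw [hρ]; linarith)
  obtain ⟨y, hy, hmax⟩ := (isCompact_closedBall a ρ).exists_isMaxOn
    ⟨a, mem_closedBall_self hρ0.le⟩
    (f := fun x => ‖f x‖ * (ρ - dist x a) ^ N)
    ((hf.continuousOn.mono hsubR).norm.mul (by fun_prop))
  set d := ρ - dist y a with hd
  have hd0 : 0 ≤ d := by have := mem_closedBall.1 hy; rw [hd]; linarith
  have hdρ : d ≤ ρ := by rw [hd]; linarith [dist_nonneg (x := y) (y := a)]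
  set A := ‖f y‖ with hA
  have hA0 : 0 ≤ A := norm_nonneg _
  have hzz : ‖f z‖ * (R / 4) ^ N ≤ A * d ^ N := by
    have hz1 := mem_ball.1 hz
    have h1 := hmax (a := z) (by rw [mem_closedBall, hρ]; linarith)
    refine le_trans ?_ h1
    show _ ≤ ‖f z‖ * (ρ - dist z a) ^ N
    gcongr
    rw [hρ]; linarith
  have powN : ∀ x : ℝ, 0 ≤ x → (x ^ N) ^ p = x ^ (2 * (D + 1)) := by
    intro x hx
    rw [← Real.rpow_natCast, ← Real.rpow_mul hx, ← Real.rpow_natCast]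
    congr 1
    rw [hN, hp]; push_cast; field_simp
  have hzp : ‖f z‖ ^ p * (R / 4) ^ (2 * (D + 1)) ≤ A ^ p * d ^ (2 * (D + 1)) := by
    have := Real.rpow_le_rpow (by positivity) hzz hp0.le
    rwa [Real.mul_rpow (by positivity) (by positivity), Real.mul_rpow (by positivity)
      (by positivity), powN _ (by positivity), powN _ hd0] at this
  have main : A ^ p * d ^ D * V1 ≤ 2 ^ D * B * I.toReal := by
    rcases hA0.eq_or_lt with hA' | hA'
    · rw [← hA', Real.zero_rpow hp0.ne', zero_mul, zero_mul]; positivity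
    rcases hd0.eq_or_lt with hd' | hd'
    · have hfa : ∀ x ∈ ball a ρ, f x = 0 := by
        intro x hx
        have h1 : ‖f x‖ * (ρ - dist x a) ^ N ≤ A * d ^ N := hmax (ball_subset_closedBall hx)
        rw [← hd', zero_pow hN0, mul_zero] at h1
        have h2 : 0 < (ρ - dist x a) ^ N := by
          have := mem_ball.1 hx
          apply pow_pos; linarith
        by_contra hne
        have : 0 < ‖f x‖ := norm_pos_iff.2 hne
        nlinarith [mul_pos this h2]
      rcases Nat.eq_zero_or_pos D with hD0 | hDp
      · -- dimension zero: only one point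
        have : Subsingleton (Fin n → ℂ) := Module.finrank_zero_iff.1 (hD ▸ hD0)
        have : f y = 0 := hfa y (by rw [Subsingleton.elim y a]; exact mem_ball_self hρ0)
        rw [hA, this] at hA'
        simp at hA'
      · rw [← hd', zero_pow hDp.ne', mul_zero, zero_mul]; positivity
    have hsub : ball y (d / 2) ⊆ ball a R := by
      apply ball_subset_ball'
      rw [hρ] at hd
      linarith
    have mv := ball_mv (f := fun x => f x ^ 2) (c := y) (s := d / 2) ((hf.mono hsub).pow 2)
    have hvol : volume (ball y (d / 2)) = ENNReal.ofReal ((d / 2) ^ D * V1) := by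
      rw [Measure.addHaar_ball_of_pos _ _ (by positivity), ENNReal.ofReal_mul (by positivity),
        ENNReal.ofReal_toReal hV1t]
    have hle : ∀ x ∈ ball y (d / 2), ‖f x ^ 2‖ₑ ≤
        ENNReal.ofReal ((2 ^ N * A) ^ (2 - p)) * (‖f x‖₊ : ℝ≥0∞) ^ p := by
      intro x hx
      have hx1 := mem_ball.1 hx
      have hxa : dist x a ≤ ρ - d / 2 := by
        have := dist_triangle x y a
        rw [hd] at hx1 ⊢
        linarith
      have h1 : ‖f x‖ * (ρ - dist x a) ^ N ≤ A * d ^ N :=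
        hmax (mem_closedBall.2 (by linarith))
      have h2 : ‖f x‖ * (d / 2) ^ N ≤ A * d ^ N := by
        refine le_trans ?_ h1
        gcongr
        linarith
      have h3 : ‖f x‖ ≤ 2 ^ N * A := by
        have h4 : (d / 2) ^ N * 2 ^ N = d ^ N := by rw [← mul_pow]; congr 1; ring
        have h5 : 0 < (d / 2) ^ N := by positivity
        rw [← h4] at h2
        nlinarith
      have e1 : (‖f x‖₊ : ℝ≥0∞) ^ p = ENNReal.ofReal (‖f x‖ ^ p) := by
        rw [← ENNReal.ofReal_rpow_of_nonneg (norm_nonneg _) hp0.le, ofReal_norm]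
        rfl
      rw [e1, ← ENNReal.ofReal_mul (by positivity), ← ofReal_norm]
      apply ENNReal.ofReal_le_ofReal
      rw [norm_pow]
      calc ‖f x‖ ^ 2 = ‖f x‖ ^ (2 - p) * ‖f x‖ ^ p := by
            rw [← Real.rpow_add_of_nonneg (norm_nonneg _) hp2 hp0.le, ← Real.rpow_natCast]
            congr 1; push_cast; ring
        _ ≤ _ := by gcongr
    have h6 : ENNReal.ofReal (A ^ 2) * ENNReal.ofReal ((d / 2) ^ D * V1) ≤
        ENNReal.ofReal ((2 ^ N * A) ^ (2 - p)) * ENNReal.ofReal I.toReal := by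
      rw [ENNReal.ofReal_toReal hIt, ← hvol]
      have e0 : ENNReal.ofReal (A ^ 2) = ‖f y ^ 2‖ₑ := by
        rw [← ofReal_norm, norm_pow]
      rw [e0]
      refine mv.trans ?_
      calc _ ≤ ∫⁻ x in ball y (d / 2), ENNReal.ofReal ((2 ^ N * A) ^ (2 - p)) *
              (‖f x‖₊ : ℝ≥0∞) ^ p := setLIntegral_mono' isOpen_ball.measurableSet hle
        _ ≤ ∫⁻ x in ball a R, ENNReal.ofReal ((2 ^ N * A) ^ (2 - p)) *
              (‖f x‖₊ : ℝ≥0∞) ^ p := lintegral_mono_set hsub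
        _ = _ := lintegral_const_mul' _ _ ENNReal.ofReal_ne_top
    rw [← ENNReal.ofReal_mul (by positivity), ← ENNReal.ofReal_mul (by positivity),
      ENNReal.ofReal_le_ofReal_iff (by positivity), Real.mul_rpow (by positivity) hA0] at h6
    have h7 : A ^ 2 = A ^ (2 - p) * A ^ p := by
      rw [← Real.rpow_add hA', ← Real.rpow_natCast]
      congr 1; push_cast; ring
    have h8 : 0 < A ^ (2 - p) := by positivity
    rw [h7] at h6
    have h9 : A ^ p * ((d / 2) ^ D * V1) ≤ B * I.toReal := by
      have : A ^ (2 - p) * (A ^ p * ((d / 2) ^ D * V1)) ≤ A ^ (2 - p) * (B * I.toReal) := by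
        rw [hB]; linarith
      exact le_of_mul_le_mul_left this h8
    have h10 : d ^ D = 2 ^ D * (d / 2) ^ D := by rw [← mul_pow]; congr 1; ring
    rw [h10]
    have : (0 : ℝ) < 2 ^ D := by positivity
    nlinarith
  have hdd : d ^ (2 * (D + 1)) ≤ d ^ D * ρ ^ (D + 2) := by
    have : 2 * (D + 1) = D + (D + 2) := by ring
    rw [this, pow_add]
    gcongr
  rw [div_mul_eq_mul_div, le_div_iff₀ (by positivity)]
  calc ‖f z‖ ^ p * (V1 * (R / 4) ^ (2 * (D + 1)))
      = (‖f z‖ ^ p * (R / 4) ^ (2 * (D + 1))) * V1 := by ring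
    _ ≤ (A ^ p * (d ^ D * ρ ^ (D + 2))) * V1 := by
        refine mul_le_mul_of_nonneg_right (hzp.trans ?_) hV10.le
        exact mul_le_mul_of_nonneg_left hdd (by positivity)
    _ = (A ^ p * d ^ D * V1) * ρ ^ (D + 2) := by ring
    _ ≤ (2 ^ D * B * I.toReal) * ρ ^ (D + 2) := by gcongr
    _ = _ := by ring

theorem mNorm_smul {E : Type*} [NormedAddCommGroup E] [NormedSpace ℂ E] [MeasureSpace E]
    (U : Set E) (ψ : E → EReal) {k : ℕ} (hk : 1 ≤ k) (u : E → ℂ) (c : ℂ) :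
    mNorm U ψ k (fun z => c * u z) = (‖c‖₊ : ℝ≥0∞) * mNorm U ψ k u := by
  have hk0 : (0 : ℝ) < k := by exact_mod_cast hk
  unfold mNorm
  have h1 : ∀ z, (‖c * u z‖₊ : ℝ≥0∞) ^ (2 / (k : ℝ)) * expE (-(ψ z) * (((k : ℝ)⁻¹ : ℝ) : EReal)) =
      (‖c‖₊ : ℝ≥0∞) ^ (2 / (k : ℝ)) * ((‖u z‖₊ : ℝ≥0∞) ^ (2 / (k : ℝ)) *
        expE (-(ψ z) * (((k : ℝ)⁻¹ : ℝ) : EReal))) := by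
    intro z
    rw [nnnorm_mul, ENNReal.coe_mul, ENNReal.mul_rpow_of_nonneg _ _ (by positivity), mul_assoc]
  simp_rw [h1]
  rw [lintegral_const_mul' _ _ (ENNReal.rpow_ne_top_of_nonneg (by positivity) ENNReal.coe_ne_top),
    ENNReal.mul_rpow_of_nonneg _ _ (by positivity), ← ENNReal.rpow_mul]
  congr 1
  have : 2 / (k : ℝ) * (k / 2) = 1 := by field_simp
  rw [this, ENNReal.rpow_one]

theorem ker_lt {E : Type*} [NormedAddCommGroup E] [NormedSpace ℂ E] [MeasureSpace E]
    {U : Set E} {ψ : E → EReal} {k : ℕ} (hk : 1 ≤ k) {x : E} {y : ℝ≥0∞}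
    (h : y < mBergmanKernel U ψ k x) :
    ∃ v : E → ℂ, DifferentiableOn ℂ v U ∧ mNorm U ψ k v ≤ 1 ∧ y < (‖v x‖₊ : ℝ≥0∞) ^ 2 := by
  unfold mBergmanKernel at h
  simp only [lt_iSup_iff] at h
  obtain ⟨u, ⟨hd, hN⟩, hy⟩ := h
  by_cases h0 : mNorm U ψ k u = 0
  · -- rescale by a large constant
    have hux : (‖u x‖₊ : ℝ≥0∞) ≠ 0 := by
      intro h
      rw [h, h0] at hy
      simp at hy
    have hyt : y ≠ ⊤ := hy.ne_top
    have hux' : u x ≠ 0 := by simpa using hux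
    refine ⟨fun z => (((y.toReal + 1 : ℝ) : ℂ) / u x) * u z, hd.const_mul _, ?_, ?_⟩
    · rw [mNorm_smul _ _ hk, h0, mul_zero]; exact zero_le_one
    · beta_reduce
      rw [div_mul_cancel₀ _ hux']
      have e : ((‖((y.toReal + 1 : ℝ) : ℂ)‖₊ : ℝ≥0∞)) = ENNReal.ofReal (y.toReal + 1) := by
        rw [← enorm_eq_nnnorm, ← ofReal_norm, Complex.norm_real, Real.norm_of_nonneg (by positivity)]
      rw [e, ← ENNReal.ofReal_pow (by positivity), ENNReal.lt_ofReal_iff_toReal_lt hyt]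
      have : 0 ≤ y.toReal := ENNReal.toReal_nonneg
      nlinarith
  · set N := mNorm U ψ k u with hNdef
    have hN0 : 0 < N.toReal := ENNReal.toReal_pos h0 hN.ne
    have e : ((‖((N.toReal : ℂ))⁻¹‖₊ : ℝ≥0∞)) = N⁻¹ := by
      rw [← enorm_eq_nnnorm, ← ofReal_norm, norm_inv, Complex.norm_real,
        Real.norm_of_nonneg hN0.le, ENNReal.ofReal_inv_of_pos hN0, ENNReal.ofReal_toReal hN.ne]
    refine ⟨fun z => ((N.toReal : ℂ))⁻¹ * u z, hd.const_mul _, ?_, ?_⟩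
    · rw [mNorm_smul _ _ hk, ← hNdef, e, ENNReal.inv_mul_cancel h0 hN.ne]
    · rw [nnnorm_mul, ENNReal.coe_mul, e, mul_pow, ← ENNReal.inv_pow, mul_comm, ← div_eq_mul_inv]
      exact hy

theorem le_ker {E : Type*} [NormedAddCommGroup E] [NormedSpace ℂ E] [MeasureSpace E]
    {U : Set E} {ψ : E → EReal} {k : ℕ} {x : E} {v : E → ℂ} (hd : DifferentiableOn ℂ v U)
    (hN : mNorm U ψ k v ≤ 1) : (‖v x‖₊ : ℝ≥0∞) ^ 2 ≤ mBergmanKernel U ψ k x := by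
  unfold mBergmanKernel
  refine le_trans ?_ (le_iSup₂ (f := fun (u : E → ℂ) (_ : u ∈ {u : E → ℂ | DifferentiableOn ℂ u U ∧
    mNorm U ψ k u < ⊤}) => ((‖u x‖₊ : ℝ≥0∞) ^ 2) / (mNorm U ψ k u) ^ 2) v
    ⟨hd, hN.trans_lt ENNReal.one_lt_top⟩)
  rw [div_eq_mul_inv]
  refine le_mul_of_one_le_right' ?_
  rw [ENNReal.one_le_inv]
  exact pow_le_one₀ zero_le hN

theorem wt_anti {k : ℕ} : Antitone (fun x : EReal => expE (-x * (((k : ℝ)⁻¹ : ℝ) : EReal))) := by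
  intro x y hxy
  apply EReal.exp_monotone
  refine mul_le_mul_of_nonneg_right (EReal.neg_le_neg_iff.2 hxy) ?_
  exact_mod_cast (by positivity : (0 : ℝ) ≤ (k : ℝ)⁻¹)

theorem wt_cont {k : ℕ} (hk : 1 ≤ k) :
    Continuous (fun x : EReal => expE (-x * (((k : ℝ)⁻¹ : ℝ) : EReal))) := by
  have hk0 : (k : ℝ)⁻¹ ≠ 0 := by
    have : (0 : ℝ) < k := by exact_mod_cast hk
    positivity
  unfold expE
  refine ENNReal.continuous_exp.comp ?_
  rw [continuous_iff_continuousAt]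
  intro x
  have h := EReal.continuousAt_mul (p := (-x, (((k : ℝ)⁻¹ : ℝ) : EReal)))
    (Or.inr (EReal.coe_ne_bot _)) (Or.inr (EReal.coe_ne_top _))
    (Or.inr (EReal.coe_ne_zero.2 hk0)) (Or.inr (EReal.coe_ne_zero.2 hk0))
  exact ContinuousAt.comp (f := fun x : EReal => (-x, (((k : ℝ)⁻¹ : ℝ) : EReal))) h
    (continuous_neg.prodMk continuous_const).continuousAt

theorem meas_lsc {E : Type*} [TopologicalSpace E] [MeasurableSpace E] [BorelSpace E]
    {s : Set E} (hs : IsOpen s) {g : E → ℝ≥0∞} (hg : LowerSemicontinuousOn g s) :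
    Measurable (s.indicator g) := by
  apply measurable_of_Ioi
  intro a
  obtain ⟨u, hu, hu'⟩ := lowerSemicontinuousOn_iff_preimage_Ioi.1 hg a
  have : s.indicator g ⁻¹' Set.Ioi a = s ∩ u := by
    rw [← hu']
    ext x
    by_cases hx : x ∈ s <;> simp [hx]
  rw [this]
  exact (hs.inter hu).measurableSet

theorem int_le_one {E : Type*} [NormedAddCommGroup E] [NormedSpace ℂ E] [MeasureSpace E]
    {U : Set E} {ψ : E → EReal} {k : ℕ} (hk : 1 ≤ k) {v : E → ℂ} : mNorm U ψ k v ≤ 1 ↔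
    (∫⁻ z in U, (‖v z‖₊ : ℝ≥0∞) ^ (2 / (k : ℝ)) *
      expE (-(ψ z) * (((k : ℝ)⁻¹ : ℝ) : EReal))) ≤ 1 := by
  have hk0 : (0 : ℝ) < k := by exact_mod_cast hk
  unfold mNorm
  conv_lhs => rw [← ENNReal.one_rpow ((k : ℝ) / 2)]
  rw [ENNReal.rpow_le_rpow_iff (by positivity)]

/-- Local uniform bounds for the unit balls of the fibre Bergman spaces. -/
theorem loc_bound {m n : ℕ} {Ω : Set ((Fin m → ℂ) × (Fin n → ℂ))} (hΩ : IsOpen Ω)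
    {φ : ((Fin m → ℂ) × (Fin n → ℂ)) → EReal} (hφ : UpperSemicontinuousOn φ Ω)
    (hφtop : ∀ w ∈ Ω, φ w < ⊤) {k : ℕ} (hk : 1 ≤ k) {t₀ : Fin m → ℂ} {a : Fin n → ℂ}
    (ha : (t₀, a) ∈ Ω) : ∃ r > 0, ∃ M : ℝ, ball a r ⊆ {z | (t₀, z) ∈ Ω} ∧
      ∀ᶠ t in 𝓝 t₀, ∀ v : (Fin n → ℂ) → ℂ, DifferentiableOn ℂ v {z | (t, z) ∈ Ω} →
        mNorm {z | (t, z) ∈ Ω} (fun z => φ (t, z)) k v ≤ 1 →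
        DifferentiableOn ℂ v (ball a r) ∧ ∀ z ∈ ball a r, ‖v z‖ ≤ M := by
  have hk0 : (0 : ℝ) < k := by exact_mod_cast hk
  obtain ⟨M, hM, -⟩ := EReal.lt_iff_exists_real_btwn.1 (hφtop _ ha)
  have hn : {w | w ∈ Ω ∧ φ w < M} ∈ 𝓝 (t₀, a) := by
    have h1 := hφ _ ha M hM
    rw [hΩ.nhdsWithin_eq ha] at h1
    filter_upwards [hΩ.mem_nhds ha, h1] with w h2 h3 using ⟨h2, h3⟩
  obtain ⟨R, hR, hball⟩ := Metric.mem_nhds_iff.1 hn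
  rw [← ball_prod_same] at hball
  obtain ⟨C, hC, hCf⟩ := sup_bound n k hk hR
  set e : ℝ≥0∞ := expE (-(M : EReal) * (((k : ℝ)⁻¹ : ℝ) : EReal)) with he
  have he' : e = ENNReal.ofReal (Real.exp (-M * (k : ℝ)⁻¹)) := by
    rw [he, ← EReal.coe_neg, ← EReal.coe_mul]
    exact EReal.exp_coe _
  have he0 : e ≠ 0 := by
    rw [he', Ne, ENNReal.ofReal_eq_zero, not_le]; positivity
  have het : e ≠ ⊤ := by rw [he']; exact ENNReal.ofReal_ne_top
  set T : ℝ := (ENNReal.ofReal C * e⁻¹).toReal with hT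
  refine ⟨R / 4, by positivity, T ^ ((2 / (k : ℝ))⁻¹), ?_, ?_⟩
  · intro z hz
    exact (hball (Set.mk_mem_prod (mem_ball_self hR) (ball_subset_ball (by linarith) hz))).1
  filter_upwards [ball_mem_nhds t₀ hR] with t ht v hv hN
  have hsub : ball a R ⊆ {z | (t, z) ∈ Ω} := fun z hz => (hball (Set.mk_mem_prod ht hz)).1
  refine ⟨hv.mono ((ball_subset_ball (by linarith)).trans hsub), fun z hz => ?_⟩
  rw [int_le_one hk] at hN
  have h1 : (∫⁻ z in ball a R, (‖v z‖₊ : ℝ≥0∞) ^ (2 / (k : ℝ))) * e ≤ 1 := by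
    refine le_trans ?_ hN
    rw [← lintegral_mul_const' _ _ het]
    refine le_trans ?_ (lintegral_mono_set hsub)
    refine setLIntegral_mono' isOpen_ball.measurableSet fun z hz => ?_
    gcongr
    exact wt_anti (k := k) (hball (Set.mk_mem_prod ht hz)).2.le
  have h2 : (∫⁻ z in ball a R, (‖v z‖₊ : ℝ≥0∞) ^ (2 / (k : ℝ))) ≤ e⁻¹ := by
    rw [ENNReal.le_inv_iff_mul_le]; exact h1
  have h3 := (hCf v a (hv.mono hsub) z hz).trans (mul_le_mul_right h2 _)
  rw [ENNReal.ofReal_le_iff_le_toReal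
    (ENNReal.mul_ne_top ENNReal.ofReal_ne_top (ENNReal.inv_ne_top.2 he0)), ← hT] at h3
  rwa [Real.le_rpow_inv_iff_of_pos (norm_nonneg _) ENNReal.toReal_nonneg (by positivity)]

theorem usc_aux {m n : ℕ} {Ω : Set ((Fin m → ℂ) × (Fin n → ℂ))} (hΩ : IsOpen Ω)
    {φ : ((Fin m → ℂ) × (Fin n → ℂ)) → EReal} (hφ : UpperSemicontinuousOn φ Ω)
    (hφtop : ∀ w ∈ Ω, φ w < ⊤) {k : ℕ} (hk : 1 ≤ k) {t₀ : Fin m → ℂ} {z₀ : Fin n → ℂ}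
    (h₀ : (t₀, z₀) ∈ Ω) {t : ℕ → Fin m → ℂ} {z : ℕ → Fin n → ℂ}
    (ht : Tendsto t atTop (𝓝 t₀)) (hz : Tendsto z atTop (𝓝 z₀)) {y : ℝ≥0∞}
    (hy : ∀ j, y < mBergmanKernel {x | (t j, x) ∈ Ω} (fun x => φ (t j, x)) k (z j)) :
    y ≤ mBergmanKernel {x | (t₀, x) ∈ Ω} (fun x => φ (t₀, x)) k z₀ := by
  have hk0 : (0 : ℝ) < k := by exact_mod_cast hk
  choose u hud huN huy using fun j => ker_lt hk (hy j)
  obtain ⟨σ, hσ, g, hg, hloc⟩ := mtl (u := u) (U := {x | (t₀, x) ∈ Ω}) (by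
    intro a ha
    obtain ⟨r, hr, M, hU, hM⟩ := loc_bound hΩ hφ hφtop hk ha
    refine ⟨r, hr, M, hU, ?_⟩
    filter_upwards [ht.eventually hM] with j hj
    exact hj _ (hud j) (huN j))
  have htσ : Tendsto (fun j => t (σ j)) atTop (𝓝 t₀) := ht.comp hσ.tendsto_atTop
  have hzσ : Tendsto (fun j => z (σ j)) atTop (𝓝 z₀) := hz.comp hσ.tendsto_atTop
  have hopen : ∀ s : Fin m → ℂ, IsOpen {x : Fin n → ℂ | (s, x) ∈ Ω} := fun s =>
    hΩ.preimage (by fun_prop)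
  set W : ((Fin m → ℂ) × (Fin n → ℂ)) → ℝ≥0∞ :=
    fun w => expE (-(φ w) * (((k : ℝ)⁻¹ : ℝ) : EReal)) with hW
  have hWlsc : LowerSemicontinuousOn W Ω :=
    (wt_cont hk).comp_upperSemicontinuousOn_antitone hφ wt_anti
  -- Fatou
  have hgN : mNorm {x | (t₀, x) ∈ Ω} (fun x => φ (t₀, x)) k g ≤ 1 := by
    rw [int_le_one hk]
    set F : ℕ → (Fin n → ℂ) → ℝ≥0∞ := fun j => {x | (t (σ j), x) ∈ Ω}.indicator
      (fun x => (‖u (σ j) x‖₊ : ℝ≥0∞) ^ (2 / (k : ℝ)) * W (t (σ j), x)) with hF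
    have hFm : ∀ j, Measurable (F j) := by
      intro j
      have e : F j = fun x => {x | (t (σ j), x) ∈ Ω}.indicator
          (fun x => (‖u (σ j) x‖₊ : ℝ≥0∞) ^ (2 / (k : ℝ))) x *
          {x | (t (σ j), x) ∈ Ω}.indicator (fun x => W (t (σ j), x)) x := by
        ext x
        by_cases hx : (t (σ j), x) ∈ Ω <;> simp [hF, hx]
      rw [e]
      refine Measurable.mul (meas_ind (hopen _) ?_) (meas_lsc (hopen _) ?_)
      · have hc : ContinuousOn (fun x => ‖u (σ j) x‖ₑ) {x | (t (σ j), x) ∈ Ω} :=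
          continuous_enorm.comp_continuousOn (hud (σ j)).continuousOn
        exact (ENNReal.continuous_rpow_const (y := 2 / (k : ℝ))).comp_continuousOn hc
      · intro x hx b hb
        have hct : Tendsto (fun x' : Fin n → ℂ => (t (σ j), x')) (𝓝 x) (𝓝 (t (σ j), x)) :=
          Continuous.tendsto (by fun_prop) x
        have h1 := hWlsc _ hx b hb
        rw [hΩ.nhdsWithin_eq hx] at h1
        exact nhdsWithin_le_nhds (hct.eventually h1)
    have hFi : ∀ j, ∫⁻ x, F j x ≤ 1 := by
      intro j
      rw [hF, lintegral_indicator (hopen _).measurableSet]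
      exact (int_le_one hk).1 (huN (σ j))
    calc _ ≤ ∫⁻ x in {x | (t₀, x) ∈ Ω}, liminf (fun j => F j x) atTop := by
          refine setLIntegral_mono' (hopen _).measurableSet fun x hx => ?_
          have hcx : Tendsto (fun j => (t (σ j), x)) atTop (𝓝 (t₀, x)) :=
            htσ.prodMk_nhds tendsto_const_nhds
          have hev : ∀ᶠ j in atTop, (t (σ j), x) ∈ Ω := hcx.eventually (hΩ.mem_nhds hx)
          have e1 : liminf (fun j => F j x) atTop =
              liminf ((fun j => (‖u (σ j) x‖₊ : ℝ≥0∞) ^ (2 / (k : ℝ))) *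
                (fun j => W (t (σ j), x))) atTop := by
            apply liminf_congr
            filter_upwards [hev] with j hj
            rw [hF]
            exact Set.indicator_of_mem (s := {x | (t (σ j), x) ∈ Ω}) hj _
          rw [e1]
          refine le_trans ?_ ENNReal.le_liminf_mul
          obtain ⟨r, hr, hT⟩ := hloc x hx
          have hp : Tendsto (fun j => (‖u (σ j) x‖₊ : ℝ≥0∞) ^ (2 / (k : ℝ))) atTop
              (𝓝 ((‖g x‖₊ : ℝ≥0∞) ^ (2 / (k : ℝ)))) :=
            ((ENNReal.continuous_rpow_const (y := 2 / (k : ℝ))).tendsto _).comp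
              ((hT.tendsto_at (mem_ball_self hr)).enorm)
          rw [hp.liminf_eq]
          gcongr
          refine (le_liminf_iff).2 fun b hb => ?_
          have h1 := hWlsc _ hx b hb
          rw [hΩ.nhdsWithin_eq hx] at h1
          exact hcx.eventually h1
      _ ≤ ∫⁻ x, liminf (fun j => F j x) atTop := setLIntegral_le_lintegral _ _
      _ ≤ liminf (fun j => ∫⁻ x, F j x) atTop := lintegral_liminf_le hFm
      _ ≤ liminf (fun _ => (1 : ℝ≥0∞)) atTop := liminf_le_liminf (Eventually.of_forall hFi)
      _ = 1 := liminf_const _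
  refine le_trans ?_ (le_ker hg hgN)
  obtain ⟨r, hr, hT⟩ := hloc z₀ h₀
  have hgc : ContinuousAt g z₀ := hg.continuousOn.continuousAt ((hopen t₀).mem_nhds h₀)
  have hconv : Tendsto (fun j => u (σ j) (z (σ j))) atTop (𝓝 (g z₀)) := by
    refine hT.tendsto_comp hgc.continuousWithinAt ?_
    rw [isOpen_ball.nhdsWithin_eq (mem_ball_self hr)]
    exact hzσ
  have h2 : Tendsto (fun j => (‖u (σ j) (z (σ j))‖₊ : ℝ≥0∞) ^ 2) atTop
      (𝓝 ((‖g z₀‖₊ : ℝ≥0∞) ^ 2)) :=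
    ((ENNReal.continuous_pow 2).tendsto _).comp hconv.enorm
  exact ge_of_tendsto' h2 fun j => (huy (σ j)).le

/-- Let `Ω ⊆ ℂ^m_t × ℂ^n_z` be a pseudoconvex domain, `p` the projection to
the `t`-variables, `φ` plurisubharmonic on `Ω` and `k ≥ 1`. Then the relative `k`-Bergman kernel
`(t,z) ↦ K_k(t,z)` (the `k`-Bergman kernel of the fiber `Ω_t` with weight `e^{-φ(t,·)}`) is
upper semicontinuous on `Ω`. -/
theorem statement13 {m n : ℕ} (Ω : Set ((Fin m → ℂ) × (Fin n → ℂ)))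
    (hΩ : IsPseudoconvexDomain Ω)
    (φ : ((Fin m → ℂ) × (Fin n → ℂ)) → EReal)
    (hφ : PlurisubharmonicOn φ Ω) (hφtop : ∀ w ∈ Ω, φ w < ⊤)
    (k : ℕ) (hk : 1 ≤ k) :
    UpperSemicontinuousOn
      (fun w : (Fin m → ℂ) × (Fin n → ℂ) =>
        mBergmanKernel {z : Fin n → ℂ | (w.1, z) ∈ Ω} (fun z => φ (w.1, z)) k w.2) Ω := by
  rw [upperSemicontinuousOn_iff_frequently]
  intro x hx y hfr
  refine le_of_forall_lt_imp_le_of_dense fun y1 hy1 => ?_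
  obtain ⟨ns, hns, hy⟩ := exists_seq_forall_of_frequently hfr
  have hns1 : Tendsto ns atTop (𝓝 x) := hns.mono_right nhdsWithin_le_nhds
  exact usc_aux hΩ.1 hφ.1 hφtop hk hx ((continuous_fst.tendsto x).comp hns1)
    ((continuous_snd.tendsto x).comp hns1) (fun j => hy1.trans_le (hy j))
end
end

section
/- Let D₁ ⊆ ℂⁿ and D₂ ⊆ ℂ^m be bounded domains and φ₁, φ₂ plurisubharmonic functions on D₁ and D₂ respectively. Then H²(D₁×D₂, e^{-(φ₁+φ₂)}) is the Hilbert tensor product of H²(D₁, e^{-φ₁}) and H²(D₂, e^{-φ₂}): if {f_i} and {g_j} are orthonormal bases of H²(D₁, e^{-φ₁}) and H²(D₂, e^{-φ₂}), then the functions (z,w) ↦ f_i(z)g_j(w) form an orthonormal basis of H²(D₁×D₂, e^{-(φ₁+φ₂)}). -/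
open MeasureTheory Complex Set
open scoped ENNReal NNReal

noncomputable section

variable {E : Type*} [NormedAddCommGroup E] [NormedSpace ℂ E] [MeasureSpace E]

/-- Membership in the weighted Bergman space `H²(D, e^{-φ})`. -/
def MemH2 (D : Set E) (φ : E → EReal) (f : E → ℂ) : Prop :=
  DifferentiableOn ℂ f D ∧ (∫⁻ z in D, (‖f z‖₊ : ℝ≥0∞) ^ 2 * expE (-(φ z))) ≠ ⊤

/-- The weighted inner product `⟨f,g⟩ = ∫_D f ḡ e^{-φ} dλ` of `H²(D, e^{-φ})`. -/
def wInner (D : Set E) (φ : E → EReal) (f g : E → ℂ) : ℂ :=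
  ∫ z in D, f z * (starRingEnd ℂ) (g z) * (((expE (-(φ z))).toReal : ℝ) : ℂ)

/-- A sequence `f : ℕ → (E → ℂ)` is an orthonormal basis of `H²(D, e^{-φ})`: its terms belong to
the space, they are orthonormal, and the only element of the space orthogonal to all of them
vanishes identically on `D`. -/
def IsONB (D : Set E) (φ : E → EReal) (f : ℕ → E → ℂ) : Prop :=
  (∀ i, MemH2 D φ (f i)) ∧
  (∀ i j, wInner D φ (f i) (f j) = if i = j then 1 else 0) ∧
  (∀ h : E → ℂ, MemH2 D φ h → (∀ i, wInner D φ h (f i) = 0) → ∀ z ∈ D, h z = 0)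

lemma aux_circle {n : ℕ} (F : (Fin n → ℂ) → ℂ) (z : Fin n → ℂ) (r : ℝ)
    (hF : DifferentiableOn ℂ F (Metric.ball z r)) (v : Fin n → ℂ) (hv : v ∈ Metric.ball 0 r) :
    ENNReal.ofReal (2 * Real.pi) * ‖F z‖ₑ ^ 2 ≤
      ∫⁻ θ in Set.Ioc 0 (2 * Real.pi), ‖F (z + circleMap 0 1 θ • v)‖ₑ ^ 2 := by
  have hv' : ‖v‖ < r := by simpa using hv
  have hmaps : ∀ t ∈ Metric.closedBall (0 : ℂ) 1, z + t • v ∈ Metric.ball z r := by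
    intro t ht
    have ht' : ‖t‖ ≤ 1 := by simpa using ht
    simp only [Metric.mem_ball, dist_self_add_left, norm_smul]
    nlinarith [norm_nonneg v]
  have hG : DifferentiableOn ℂ (fun t : ℂ => F (z + t • v) ^ 2) (Metric.closedBall 0 1) := by
    apply DifferentiableOn.pow
    apply hF.comp (by fun_prop) hmaps
  have h1 := DiffContOnCl.circleAverage (f := fun t : ℂ => F (z + t • v) ^ 2) (c := 0) (R := 1)
    (by rw [abs_one]; exact hG.diffContOnCl_ball subset_rfl)
  rw [Real.circleAverage_def] at h1
  simp only [zero_smul, add_zero] at h1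
  have h2 : (∫ θ in (0:ℝ)..2 * Real.pi, F (z + circleMap 0 1 θ • v) ^ 2)
      = ((2 * Real.pi : ℝ) : ℂ) * F z ^ 2 := by
    rw [← h1, Complex.real_smul, ← mul_assoc, ← Complex.ofReal_mul, mul_inv_cancel₀ (by positivity)]
    simp
  calc ENNReal.ofReal (2 * Real.pi) * ‖F z‖ₑ ^ 2
      = ‖((2 * Real.pi : ℝ) : ℂ) * F z ^ 2‖ₑ := by
        rw [enorm_mul, enorm_pow, ← ofReal_norm (((2 * Real.pi : ℝ) : ℂ)),
          Complex.norm_real, Real.norm_of_nonneg (by positivity)]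
    _ = ‖∫ θ in Set.Ioc 0 (2 * Real.pi), F (z + circleMap 0 1 θ • v) ^ 2‖ₑ := by
        rw [← h2, intervalIntegral.integral_of_le (by positivity)]
    _ ≤ ∫⁻ θ in Set.Ioc 0 (2 * Real.pi), ‖F (z + circleMap 0 1 θ • v) ^ 2‖ₑ :=
        enorm_integral_le_lintegral_enorm _
    _ = _ := by simp only [enorm_pow]

lemma aux_rot {n : ℕ} (z : Fin n → ℂ) (θ : ℝ) :
    MeasurePreserving (fun v : Fin n → ℂ => z + circleMap 0 1 θ • v) volume volume := by
  have h1 : MeasurePreserving (fun v : Fin n → ℂ => circleMap 0 1 θ • v) volume volume := by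
    have := volume_preserving_pi (ι := Fin n) (α' := fun _ => ℂ) (β' := fun _ => ℂ)
      (f := fun _ => rotation ⟨circleMap 0 1 θ, by simp [Submonoid.unitSphere]⟩)
      (fun _ => LinearIsometryEquiv.measurePreserving _)
    exact this
  exact (measurePreserving_add_left volume z).comp h1

lemma aux_submean {n : ℕ} (F : (Fin n → ℂ) → ℂ) (z : Fin n → ℂ) (r : ℝ)
    (hF : DifferentiableOn ℂ F (Metric.ball z r)) :
    volume (Metric.ball (0 : Fin n → ℂ) r) * ‖F z‖ₑ ^ 2 ≤
      ∫⁻ v in Metric.ball z r, ‖F v‖ₑ ^ 2 := by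
  have hpi : ENNReal.ofReal (2 * Real.pi) ≠ 0 := by
    simpa using Real.pi_pos
  have hmaps : ∀ (θ : ℝ) (v : Fin n → ℂ),
      z + circleMap 0 1 θ • v ∈ Metric.ball z r ↔ v ∈ Metric.ball 0 r := by
    intro θ v
    simp [norm_smul]
  have hrot : ∀ θ : ℝ, ∫⁻ v in Metric.ball (0 : Fin n → ℂ) r, ‖F (z + circleMap 0 1 θ • v)‖ₑ ^ 2
      = ∫⁻ v in Metric.ball z r, ‖F v‖ₑ ^ 2 := by
    intro θ
    have he : MeasurableEmbedding (fun v : Fin n → ℂ => z + circleMap 0 1 θ • v) := by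
      have : circleMap 0 1 θ ≠ 0 := by simp
      exact ((Homeomorph.smulOfNeZero _ this).trans (Homeomorph.addLeft z)).measurableEmbedding
    rw [← (aux_rot z θ).setLIntegral_comp_preimage_emb he (fun v => ‖F v‖ₑ ^ 2) (Metric.ball z r)]
    congr 2
    ext v
    exact (hmaps θ v).symm
  have hmeas : AEMeasurable (fun p : (Fin n → ℂ) × ℝ => ‖F (z + circleMap 0 1 p.2 • p.1)‖ₑ ^ 2)
      ((volume.restrict (Metric.ball (0 : Fin n → ℂ) r)).prod
        (volume.restrict (Set.Ioc 0 (2 * Real.pi)))) := by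
    rw [Measure.prod_restrict]
    apply AEMeasurable.pow_const
    apply AEMeasurable.enorm
    refine ContinuousOn.aemeasurable ?_ (measurableSet_ball.prod measurableSet_Ioc)
    refine hF.continuousOn.comp ?_ ?_
    · apply Continuous.continuousOn
      have := continuous_circleMap 0 1
      fun_prop
    · intro p hp
      exact (hmaps _ _).2 hp.1
  have key : ENNReal.ofReal (2 * Real.pi) * (volume (Metric.ball (0 : Fin n → ℂ) r) * ‖F z‖ₑ ^ 2)
      ≤ ENNReal.ofReal (2 * Real.pi) * ∫⁻ v in Metric.ball z r, ‖F v‖ₑ ^ 2 := by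
    calc _ = ∫⁻ v in Metric.ball (0 : Fin n → ℂ) r, ENNReal.ofReal (2 * Real.pi) * ‖F z‖ₑ ^ 2 := by
          rw [setLIntegral_const]; ring
      _ ≤ ∫⁻ v in Metric.ball (0 : Fin n → ℂ) r, ∫⁻ θ in Set.Ioc 0 (2 * Real.pi),
            ‖F (z + circleMap 0 1 θ • v)‖ₑ ^ 2 :=
          setLIntegral_mono' measurableSet_ball fun v hv => aux_circle F z r hF v hv
      _ = ∫⁻ θ in Set.Ioc 0 (2 * Real.pi), ∫⁻ v in Metric.ball (0 : Fin n → ℂ) r,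
            ‖F (z + circleMap 0 1 θ • v)‖ₑ ^ 2 := lintegral_lintegral_swap hmeas
      _ = _ := by
          simp only [hrot]
          rw [setLIntegral_const, Real.volume_Ioc, sub_zero, mul_comm]
  exact (ENNReal.mul_le_mul_iff_right hpi ENNReal.ofReal_ne_top).1 key

lemma aux_fderiv_bound {n : ℕ} (F : (Fin n → ℂ) → ℂ) (z₀ : Fin n → ℂ) (r : ℝ) (hr : 0 < r)
    (hF : DifferentiableOn ℂ F (Metric.ball z₀ (2 * r))) (S : ℝ)
    (hS : ∀ z ∈ Metric.ball z₀ (2 * r), ‖F z‖ ≤ S) (z : Fin n → ℂ) (hz : z ∈ Metric.ball z₀ r) :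
    ‖fderiv ℂ F z‖ ≤ S / r := by
  have hz2 : z ∈ Metric.ball z₀ (2 * r) := Metric.ball_subset_ball (by linarith) hz
  have hS0 : 0 ≤ S := (norm_nonneg _).trans (hS z hz2)
  refine ContinuousLinearMap.opNorm_le_bound _ (by positivity) fun v => ?_
  rcases eq_or_ne v 0 with rfl | hv
  · simp
  have hvn : 0 < ‖v‖ := norm_pos_iff.2 hv
  have hmaps : ∀ t ∈ Metric.closedBall (0 : ℂ) (r / ‖v‖), z + t • v ∈ Metric.ball z₀ (2 * r) := by
    intro t ht
    have ht' : ‖t‖ * ‖v‖ ≤ r := by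
      rw [← le_div_iff₀ hvn]; simpa using ht
    have h1 : dist z z₀ < r := hz
    have h2 : dist (z + t • v) z ≤ r := by simpa [norm_smul] using ht'
    have := dist_triangle (z + t • v) z z₀
    simp only [Metric.mem_ball]; linarith
  have hd : DifferentiableOn ℂ (fun t : ℂ => F (z + t • v)) (Metric.closedBall 0 (r / ‖v‖)) :=
    hF.comp (by fun_prop) hmaps
  have h1 := Complex.norm_deriv_le_of_forall_mem_sphere_norm_le (f := fun t : ℂ => F (z + t • v))
    (c := 0) (R := r / ‖v‖) (C := S) (by positivity) (hd.diffContOnCl_ball subset_rfl)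
    (fun t ht => hS _ (hmaps t (Metric.sphere_subset_closedBall ht)))
  have h2 : HasFDerivAt F (fderiv ℂ F z) z :=
    (hF.differentiableAt (Metric.isOpen_ball.mem_nhds hz2)).hasFDerivAt
  have h3 : HasDerivAt (fun t : ℂ => F (z + t • v)) (fderiv ℂ F z v) 0 := by
    have h4 : HasDerivAt (fun t : ℂ => z + t • v) v 0 := by
      simpa using ((hasDerivAt_id (0:ℂ)).smul_const v).const_add z
    have h5 : HasFDerivAt F (fderiv ℂ F z) (z + (0:ℂ) • v) := by simpa using h2
    exact h5.comp_hasDerivAt (0:ℂ) h4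
  rw [h3.deriv] at h1
  calc _ ≤ _ := h1
    _ = _ := by field_simp

lemma aux_integrable {α : Type*} [MeasurableSpace α] {μ : Measure α} {u v : α → ℂ}
    {w : α → ℝ≥0∞} (hu : AEStronglyMeasurable u μ) (hv : AEStronglyMeasurable v μ)
    (hw : AEMeasurable w μ) (hu2 : ∫⁻ a, ‖u a‖ₑ ^ 2 * w a ∂μ ≠ ⊤)
    (hv2 : ∫⁻ a, ‖v a‖ₑ ^ 2 * w a ∂μ ≠ ⊤) :
    Integrable (fun a => u a * (starRingEnd ℂ) (v a) * (((w a).toReal : ℝ) : ℂ)) μ := by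
  refine ⟨?_, ?_⟩
  · exact (hu.mul (Complex.continuous_conj.comp_aestronglyMeasurable hv)).mul
      (Complex.continuous_ofReal.comp_aestronglyMeasurable
        hw.ennreal_toReal.aestronglyMeasurable)
  · rw [HasFiniteIntegral]
    calc _ ≤ ∫⁻ a, (‖u a‖ₑ ^ 2 * w a + ‖v a‖ₑ ^ 2 * w a) ∂μ := by
          apply lintegral_mono
          intro a
          simp only
          rw [← add_mul, enorm_mul]
          gcongr
          · rw [enorm_mul, RCLike.enorm_conj]
            rcases le_total ‖u a‖ₑ ‖v a‖ₑ with h | h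
            · calc _ ≤ ‖v a‖ₑ * ‖v a‖ₑ := by gcongr
                _ ≤ _ := by rw [sq, sq]; exact le_add_self
            · calc _ ≤ ‖u a‖ₑ * ‖u a‖ₑ := by gcongr
                _ ≤ _ := by rw [sq, sq]; exact le_self_add
          · rw [← ofReal_norm, Complex.norm_real, Real.norm_of_nonneg ENNReal.toReal_nonneg]
            exact ENNReal.ofReal_toReal_le
      _ = _ := lintegral_add_left' ((hu.enorm.pow_const 2).mul hw) _
      _ < ⊤ := by simp [lt_top_iff_ne_top, hu2, hv2]

lemma aux_CS {α : Type*} [MeasurableSpace α] {μ : Measure α} {u v : α → ℂ}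
    {w : α → ℝ≥0∞} (hu : AEStronglyMeasurable u μ) (hv : AEStronglyMeasurable v μ)
    (hw : AEMeasurable w μ) :
    ‖∫ a, u a * (starRingEnd ℂ) (v a) * (((w a).toReal : ℝ) : ℂ) ∂μ‖ₑ ^ 2 ≤
      (∫⁻ a, ‖u a‖ₑ ^ 2 * w a ∂μ) * (∫⁻ a, ‖v a‖ₑ ^ 2 * w a ∂μ) := by
  set ν := μ.withDensity w
  have hac : ν ≪ μ := withDensity_absolutelyContinuous _ _
  have hu' : AEMeasurable (fun a => ‖u a‖ₑ) ν := hu.enorm.mono_ac hac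
  have hv' : AEMeasurable (fun a => ‖v a‖ₑ) ν := hv.enorm.mono_ac hac
  have e1 : ∀ k : α → ℝ≥0∞, AEMeasurable k μ → ∫⁻ a, k a ∂ν = ∫⁻ a, k a * w a ∂μ := by
    intro k hk
    rw [lintegral_withDensity_eq_lintegral_mul₀ hw hk]
    simp [mul_comm]
  have h1 : ‖∫ a, u a * (starRingEnd ℂ) (v a) * (((w a).toReal : ℝ) : ℂ) ∂μ‖ₑ ≤
      ∫⁻ a, ‖u a‖ₑ * ‖v a‖ₑ ∂ν := by
    rw [e1 (fun a => ‖u a‖ₑ * ‖v a‖ₑ) (hu.enorm.mul hv.enorm)]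
    refine (enorm_integral_le_lintegral_enorm _).trans (lintegral_mono fun a => ?_)
    simp only
    rw [enorm_mul, enorm_mul, RCLike.enorm_conj]
    gcongr
    rw [← ofReal_norm, Complex.norm_real, Real.norm_of_nonneg ENNReal.toReal_nonneg]
    exact ENNReal.ofReal_toReal_le
  have h2 := ENNReal.lintegral_mul_le_Lp_mul_Lq ν Real.HolderConjugate.two_two hu' hv'
  simp only [Pi.mul_apply, ENNReal.rpow_two] at h2
  calc _ ≤ _ := pow_le_pow_left' (h1.trans h2) 2
    _ = _ := by
      rw [mul_pow, ← ENNReal.rpow_two, ← ENNReal.rpow_two, ← ENNReal.rpow_mul, ← ENNReal.rpow_mul,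
        e1 _ (hu.enorm.pow_const 2), e1 _ (hv.enorm.pow_const 2)]
      norm_num

lemma aux_weight {X : Type*} [TopologicalSpace X] [MeasurableSpace X] [OpensMeasurableSpace X]
    {μ : Measure X} {φ : X → EReal} {D : Set X} (hD : IsOpen D)
    (hφ : UpperSemicontinuousOn φ D) :
    AEMeasurable (fun z => expE (-(φ z))) (μ.restrict D) := by
  apply aemeasurable_restrict_of_measurable_subtype hD.measurableSet
  have h1 : Measurable (D.domRestrict φ) :=
    UpperSemicontinuous.measurable (upperSemicontinuousOn_iff_restrict.2 hφ)
  exact EReal.measurable_exp.comp h1.neg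

lemma aux_exp_add {a b : EReal} (ha : a < ⊤) (hb : b < ⊤) :
    expE (-(a + b)) = expE (-a) * expE (-b) := by
  unfold expE
  rw [EReal.neg_add (Or.inr hb.ne) (Or.inl ha.ne), sub_eq_add_neg, EReal.exp_add]

lemma aux_low {X : Type*} [TopologicalSpace X] {φ : X → EReal} {D : Set X} (hD : IsOpen D)
    (hφ : UpperSemicontinuousOn φ D) (htop : ∀ z ∈ D, φ z < ⊤) (z : X) (hz : z ∈ D) :
    ∃ c : ℝ≥0∞, c ≠ 0 ∧ c ≠ ⊤ ∧ ∀ᶠ y in nhds z, c ≤ expE (-(φ y)) := by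
  obtain ⟨M, hM1, hM2⟩ := EReal.lt_iff_exists_real_btwn.1 (htop z hz)
  refine ⟨EReal.exp (-(M : EReal)), ?_, ?_, ?_⟩
  · rw [Ne, EReal.exp_eq_zero_iff]; simp
  · rw [Ne, EReal.exp_eq_top_iff]; simp
  · have := hφ z hz M hM1
    rw [hD.nhdsWithin_eq hz] at this
    filter_upwards [this] with y hy
    unfold expE
    rw [EReal.exp_le_exp_iff, EReal.neg_le_neg_iff]
    exact hy.le

lemma aux_local {n m : ℕ} {D₁ : Set (Fin n → ℂ)} {D₂ : Set (Fin m → ℂ)}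
    (h₁ : IsOpen D₁) (h₂ : IsOpen D₂) {h : (Fin n → ℂ) × (Fin m → ℂ) → ℂ}
    (hh : DifferentiableOn ℂ h (D₁ ×ˢ D₂)) {w₁ : (Fin n → ℂ) → ℝ≥0∞} {w₂ : (Fin m → ℂ) → ℝ≥0∞}
    (hw₁ : AEMeasurable w₁ (volume.restrict D₁)) (hw₂ : AEMeasurable w₂ (volume.restrict D₂))
    (hlow : ∀ z ∈ D₁, ∃ c : ℝ≥0∞, c ≠ 0 ∧ c ≠ ⊤ ∧ ∀ᶠ y in nhds z, c ≤ w₁ y)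
    (hfin : ∫⁻ p in D₁ ×ˢ D₂, ‖h p‖ₑ ^ 2 * (w₁ p.1 * w₂ p.2) ≠ ⊤)
    (z₀ : Fin n → ℂ) (hz₀ : z₀ ∈ D₁) :
    ∃ r > 0, Metric.ball z₀ (3 * r) ⊆ D₁ ∧ ∃ G : (Fin m → ℂ) → ℝ≥0∞,
      AEMeasurable G (volume.restrict D₂) ∧ ∫⁻ w in D₂, G w * w₂ w ≠ ⊤ ∧
      ∀ w ∈ D₂, ∀ z ∈ Metric.ball z₀ (2 * r), ‖h (z, w)‖ₑ ^ 2 ≤ G w := by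
  obtain ⟨c, hc0, hct, hc⟩ := hlow z₀ hz₀
  obtain ⟨R, hR, hball⟩ := Metric.mem_nhds_iff.1 (Filter.inter_mem (h₁.mem_nhds hz₀) hc)
  obtain ⟨r, hr, rfl⟩ : ∃ r > 0, R = 3 * r := ⟨R / 3, by positivity, by ring⟩
  have hb1 : Metric.ball z₀ (3 * r) ⊆ D₁ := fun y hy => (hball hy).1
  have hb2 : ∀ y ∈ Metric.ball z₀ (3 * r), c ≤ w₁ y := fun y hy => (hball hy).2
  set V := volume (Metric.ball (0 : Fin n → ℂ) r) with hV
  have hV0 : V ≠ 0 := (Metric.measure_ball_pos _ _ hr).ne'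
  have hVt : V ≠ ⊤ := measure_ball_lt_top.ne
  have hm : AEMeasurable (fun p => ‖h p‖ₑ ^ 2) ((volume.restrict D₁).prod (volume.restrict D₂)) := by
    rw [Measure.prod_restrict]
    exact (hh.continuousOn.aemeasurable (h₁.prod h₂).measurableSet).enorm.pow_const 2
  have hm' : AEMeasurable (fun p => ‖h p‖ₑ ^ 2)
      ((volume.restrict (Metric.ball z₀ (3 * r))).prod (volume.restrict D₂)) := by
    rw [Measure.prod_restrict] at hm ⊢
    exact hm.mono_measure (Measure.restrict_mono (Set.prod_mono hb1 subset_rfl) le_rfl)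
  have hI := hm'.lintegral_prod_left'
  have hms : ∀ w ∈ D₂, ContinuousOn (fun z => h (z, w)) D₁ := fun w hw =>
    hh.continuousOn.comp (by fun_prop) (fun z hz => ⟨hz, hw⟩)
  refine ⟨r, hr, hb1, fun w => V⁻¹ * ∫⁻ z in Metric.ball z₀ (3 * r), ‖h (z, w)‖ₑ ^ 2,
    hI.const_mul _, ?_, ?_⟩
  · have hle : c * ∫⁻ w in D₂, (∫⁻ z in Metric.ball z₀ (3 * r), ‖h (z, w)‖ₑ ^ 2) * w₂ w ≤
        ∫⁻ p in D₁ ×ˢ D₂, ‖h p‖ₑ ^ 2 * (w₁ p.1 * w₂ p.2) := by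
      rw [Measure.volume_eq_prod, ← Measure.prod_restrict, lintegral_prod_symm
        (fun p : (Fin n → ℂ) × (Fin m → ℂ) => ‖h p‖ₑ ^ 2 * (w₁ p.1 * w₂ p.2))
        (hm.mul (hw₁.comp_fst.mul hw₂.comp_snd)), ← lintegral_const_mul' _ _ hct]
      refine setLIntegral_mono' h₂.measurableSet fun w hw => ?_
      have hmw : AEMeasurable (fun z => ‖h (z, w)‖ₑ ^ 2) (volume.restrict D₁) :=
        ((hms w hw).aemeasurable h₁.measurableSet).enorm.pow_const 2
      calc c * ((∫⁻ z in Metric.ball z₀ (3 * r), ‖h (z, w)‖ₑ ^ 2) * w₂ w)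
          = (∫⁻ z in Metric.ball z₀ (3 * r), ‖h (z, w)‖ₑ ^ 2 * c) * w₂ w := by
            rw [lintegral_mul_const' _ _ hct]; ring
        _ ≤ (∫⁻ z in D₁, ‖h (z, w)‖ₑ ^ 2 * w₁ z) * w₂ w := by
            gcongr ?_ * _
            calc _ ≤ ∫⁻ z in Metric.ball z₀ (3 * r), ‖h (z, w)‖ₑ ^ 2 * w₁ z :=
                  setLIntegral_mono' measurableSet_ball fun z hz => by
                    gcongr; exact hb2 z hz
              _ ≤ _ := lintegral_mono_set hb1
        _ = _ := by
            rw [← lintegral_mul_const'' (f := fun z => ‖h (z, w)‖ₑ ^ 2 * w₁ z) _ (hmw.mul hw₁)]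
            simp only [mul_assoc]
    have hfin2 : ∫⁻ w in D₂, (∫⁻ z in Metric.ball z₀ (3 * r), ‖h (z, w)‖ₑ ^ 2) * w₂ w ≠ ⊤ := by
      intro htop
      rw [htop, ENNReal.mul_top hc0] at hle
      exact hfin (top_le_iff.1 hle)
    simp only [mul_assoc]
    rw [lintegral_const_mul' _ _ (ENNReal.inv_ne_top.2 hV0)]
    exact ENNReal.mul_ne_top (ENNReal.inv_ne_top.2 hV0) hfin2
  · intro w hw z hz
    have hsub : Metric.ball z r ⊆ Metric.ball z₀ (3 * r) := by
      apply Metric.ball_subset_ball'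
      have : dist z z₀ < 2 * r := hz
      linarith
    have hd : DifferentiableOn ℂ (fun z => h (z, w)) (Metric.ball z r) :=
      hh.comp (by fun_prop) (fun y hy => ⟨hb1 (hsub hy), hw⟩)
    have := aux_submean (fun z => h (z, w)) z r hd
    calc ‖h (z, w)‖ₑ ^ 2 = V⁻¹ * (V * ‖h (z, w)‖ₑ ^ 2) := by
          rw [← mul_assoc, ENNReal.inv_mul_cancel hV0 hVt, one_mul]
      _ ≤ _ := by
          exact mul_le_mul_right (this.trans (lintegral_mono_set hsub)) _

lemma aux_hol {n m : ℕ} {D₁ : Set (Fin n → ℂ)} {D₂ : Set (Fin m → ℂ)}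
    (h₁ : IsOpen D₁) (h₂ : IsOpen D₂) {h : (Fin n → ℂ) × (Fin m → ℂ) → ℂ}
    (hh : DifferentiableOn ℂ h (D₁ ×ˢ D₂)) {w₁ : (Fin n → ℂ) → ℝ≥0∞} {w₂ : (Fin m → ℂ) → ℝ≥0∞}
    (hw₁ : AEMeasurable w₁ (volume.restrict D₁)) (hw₂ : AEMeasurable w₂ (volume.restrict D₂))
    (hlow : ∀ z ∈ D₁, ∃ c : ℝ≥0∞, c ≠ 0 ∧ c ≠ ⊤ ∧ ∀ᶠ y in nhds z, c ≤ w₁ y)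
    (hfin : ∫⁻ p in D₁ ×ˢ D₂, ‖h p‖ₑ ^ 2 * (w₁ p.1 * w₂ p.2) ≠ ⊤)
    (hw₂0 : ∀ w ∈ D₂, w₂ w ≠ 0)
    {g : (Fin m → ℂ) → ℂ} (hg : AEStronglyMeasurable g (volume.restrict D₂))
    (hg2 : ∫⁻ w in D₂, ‖g w‖ₑ ^ 2 * w₂ w ≠ ⊤) :
    DifferentiableOn ℂ
      (fun z => ∫ w in D₂, h (z, w) * (starRingEnd ℂ) (g w) * (((w₂ w).toReal : ℝ) : ℂ)) D₁ := by
  intro z₀ hz₀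
  apply DifferentiableAt.differentiableWithinAt
  obtain ⟨r, hr, hb, G, hG, hG2, hGb⟩ := aux_local h₁ h₂ hh hw₁ hw₂ hlow hfin z₀ hz₀
  have hb2 : Metric.ball z₀ (2 * r) ⊆ D₁ :=
    (Metric.ball_subset_ball (by linarith)).trans hb
  have hb1 : Metric.ball z₀ r ⊆ Metric.ball z₀ (2 * r) :=
    Metric.ball_subset_ball (by linarith)
  have hslice : ∀ z ∈ D₁, AEStronglyMeasurable (fun w => h (z, w)) (volume.restrict D₂) := by
    intro z hz
    refine ContinuousOn.aestronglyMeasurable ?_ h₂.measurableSet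
    exact hh.continuousOn.comp (by fun_prop) (fun w hw => ⟨hz, hw⟩)
  have hslice2 : ∀ z ∈ Metric.ball z₀ (2 * r), ∫⁻ w in D₂, ‖h (z, w)‖ₑ ^ 2 * w₂ w ≠ ⊤ := by
    intro z hz
    refine ne_top_of_le_ne_top hG2 (setLIntegral_mono' h₂.measurableSet fun w hw => ?_)
    gcongr
    exact hGb w hw z hz
  have hint : ∀ z ∈ Metric.ball z₀ (2 * r), Integrable
      (fun w => h (z, w) * (starRingEnd ℂ) (g w) * (((w₂ w).toReal : ℝ) : ℂ))
      (volume.restrict D₂) := fun z hz =>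
    aux_integrable (hslice z (hb2 hz)) hg hw₂ (hslice2 z hz) hg2
  let K : (Fin m → ℂ) → ℂ := fun w => (starRingEnd ℂ) (g w) * (((w₂ w).toReal : ℝ) : ℂ)
  have hK : AEStronglyMeasurable K (volume.restrict D₂) :=
    (Complex.continuous_conj.comp_aestronglyMeasurable hg).mul
      (Complex.continuous_ofReal.comp_aestronglyMeasurable
        hw₂.ennreal_toReal.aestronglyMeasurable)
  let A : (Fin n → ℂ) → (Fin m → ℂ) → ((Fin n → ℂ) →L[ℂ] ℂ) := fun z w =>
    (fderiv ℂ h (z, w)).comp (ContinuousLinearMap.inl ℂ (Fin n → ℂ) (Fin m → ℂ))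
  have hA : ∀ z ∈ D₁, ∀ w ∈ D₂, HasFDerivAt (fun z => h (z, w)) (A z w) z := by
    intro z hz w hw
    have h1 : HasFDerivAt h (fderiv ℂ h (z, w)) (z, w) :=
      (hh.differentiableAt ((h₁.prod h₂).mem_nhds ⟨hz, hw⟩)).hasFDerivAt
    exact h1.comp z (hasFDerivAt_prodMk_left z w)
  have hAmeas : AEStronglyMeasurable (A z₀) (volume.restrict D₂) := by
    have h1 : Measurable (fun w => fderiv ℂ h (z₀, w)) :=
      (measurable_fderiv ℂ h).comp (by fun_prop)
    have : ProperSpace ((Fin n → ℂ) × (Fin m → ℂ) →L[ℂ] ℂ) := FiniteDimensional.proper ℂ _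
    have h2 : StronglyMeasurable (fun w => fderiv ℂ h (z₀, w)) := h1.stronglyMeasurable
    have h3 : Continuous (fun L : (Fin n → ℂ) × (Fin m → ℂ) →L[ℂ] ℂ =>
      L.comp (ContinuousLinearMap.inl ℂ (Fin n → ℂ) (Fin m → ℂ))) := by fun_prop
    exact (h3.comp_stronglyMeasurable h2).aestronglyMeasurable
  have hGfin : ∀ᵐ w ∂(volume.restrict D₂), G w ≠ ⊤ := by
    have h1 := ae_lt_top' (hG.mul hw₂) hG2
    filter_upwards [h1, ae_restrict_mem h₂.measurableSet] with w hw hwD htop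
    simp only [Pi.mul_apply] at hw
    rw [htop, ENNReal.top_mul (hw₂0 w hwD)] at hw
    exact lt_irrefl _ hw
  have main := hasFDerivAt_integral_of_dominated_of_fderiv_le (𝕜 := ℂ)
    (μ := volume.restrict D₂) (x₀ := z₀) (s := Metric.ball z₀ r)
    (F := fun z w => h (z, w) * (starRingEnd ℂ) (g w) * (((w₂ w).toReal : ℝ) : ℂ))
    (F' := fun z w => K w • A z w)
    (bound := fun w => (G w * w₂ w).toReal / r ^ 2 + (‖g w‖ₑ ^ 2 * w₂ w).toReal)
    (Metric.ball_mem_nhds z₀ hr)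
    (by
      filter_upwards [Metric.ball_mem_nhds z₀ hr] with z hz
      exact (hint z (hb1 hz)).aestronglyMeasurable)
    (hint z₀ (Metric.mem_ball_self (by positivity)))
    (hK.smul hAmeas)
    (by
      filter_upwards [hGfin, ae_restrict_mem h₂.measurableSet] with w hGw hw z hz
      have hS : ∀ z ∈ Metric.ball z₀ (2 * r), ‖h (z, w)‖ ≤ Real.sqrt (G w).toReal := by
        intro z hz
        apply Real.le_sqrt_of_sq_le
        have := ENNReal.toReal_mono hGw (hGb w hw z hz)
        simpa using this
      have h1 := aux_fderiv_bound (fun z => h (z, w)) z₀ r hr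
        (hh.comp (by fun_prop) (fun y hy => ⟨hb2 hy, hw⟩)) _ hS z hz
      rw [(hA z (hb2 (hb1 hz)) w hw).fderiv] at h1
      have hsq : Real.sqrt (G w).toReal ^ 2 = (G w).toReal := Real.sq_sqrt ENNReal.toReal_nonneg
      set S := Real.sqrt (G w).toReal
      have hW : 0 ≤ (w₂ w).toReal := ENNReal.toReal_nonneg
      have hKn : ‖K w‖ = ‖g w‖ * (w₂ w).toReal := by
        simp only [K]
        rw [norm_mul, RCLike.norm_conj, Complex.norm_real, Real.norm_of_nonneg hW]
      rw [norm_smul, hKn, ENNReal.toReal_mul, ENNReal.toReal_mul, ← hsq, ENNReal.toReal_pow,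
        toReal_enorm]
      calc ‖g w‖ * (w₂ w).toReal * ‖A z w‖ ≤ ‖g w‖ * (w₂ w).toReal * (S / r) := by gcongr
        _ = (‖g w‖ * (S / r)) * (w₂ w).toReal := by ring
        _ ≤ ((S / r) ^ 2 + ‖g w‖ ^ 2) * (w₂ w).toReal := by
            gcongr
            nlinarith [sq_nonneg (‖g w‖ - S / r), sq_nonneg (‖g w‖), sq_nonneg (S / r)]
        _ = _ := by rw [div_pow]; ring)
    (((integrable_toReal_of_lintegral_ne_top (hG.mul hw₂) hG2).div_const _).add
      (integrable_toReal_of_lintegral_ne_top ((hg.enorm.pow_const 2).mul hw₂) hg2))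
    (by
      filter_upwards [ae_restrict_mem h₂.measurableSet] with w hw z hz
      have := (hA z (hb2 (hb1 hz)) w hw).mul_const (K w)
      simp only [K] at this ⊢
      simpa only [mul_assoc] using this)
  exact main.differentiableAt

/-- Let `D₁ ⊆ ℂⁿ`, `D₂ ⊆ ℂᵐ` be bounded domains and `φ₁, φ₂`
plurisubharmonic. Then `H²(D₁×D₂, e^{-(φ₁+φ₂)})` is the Hilbert tensor product of
`H²(D₁, e^{-φ₁})` and `H²(D₂, e^{-φ₂})`: if `{f_i}`, `{g_j}` are orthonormal bases of the two
factors, then `(z,w) ↦ f_i(z)·g_j(w)` is an orthonormal basis of the product space. -/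
theorem statement18 {n m : ℕ} (D₁ : Set (Fin n → ℂ)) (D₂ : Set (Fin m → ℂ))
    (h₁open : IsOpen D₁) (h₁conn : IsConnected D₁) (h₁bdd : Bornology.IsBounded D₁)
    (h₂open : IsOpen D₂) (h₂conn : IsConnected D₂) (h₂bdd : Bornology.IsBounded D₂)
    (φ₁ : (Fin n → ℂ) → EReal) (φ₂ : (Fin m → ℂ) → EReal)
    (hφ₁ : PlurisubharmonicOn φ₁ D₁) (hφ₁top : ∀ z ∈ D₁, φ₁ z < ⊤)
    (hφ₂ : PlurisubharmonicOn φ₂ D₂) (hφ₂top : ∀ z ∈ D₂, φ₂ z < ⊤)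
    (f : ℕ → (Fin n → ℂ) → ℂ) (g : ℕ → (Fin m → ℂ) → ℂ)
    (hf : IsONB D₁ φ₁ f) (hg : IsONB D₂ φ₂ g) :
    (∀ i j, MemH2 (D₁ ×ˢ D₂) (fun w => φ₁ w.1 + φ₂ w.2)
        (fun w : (Fin n → ℂ) × (Fin m → ℂ) => f i w.1 * g j w.2)) ∧
    (∀ i j i' j',
        wInner (D₁ ×ˢ D₂) (fun w => φ₁ w.1 + φ₂ w.2)
            (fun w : (Fin n → ℂ) × (Fin m → ℂ) => f i w.1 * g j w.2)
            (fun w : (Fin n → ℂ) × (Fin m → ℂ) => f i' w.1 * g j' w.2) =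
          if i = i' ∧ j = j' then 1 else 0) ∧
    (∀ h : ((Fin n → ℂ) × (Fin m → ℂ)) → ℂ,
        MemH2 (D₁ ×ˢ D₂) (fun w => φ₁ w.1 + φ₂ w.2) h →
        (∀ i j, wInner (D₁ ×ˢ D₂) (fun w => φ₁ w.1 + φ₂ w.2) h
            (fun w : (Fin n → ℂ) × (Fin m → ℂ) => f i w.1 * g j w.2) = 0) →
        ∀ w ∈ D₁ ×ˢ D₂, h w = 0) := by

  obtain ⟨hf1, hf2, hf3⟩ := hf
  obtain ⟨hg1, hg2, hg3⟩ := hg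
  have h12 : IsOpen (D₁ ×ˢ D₂) := h₁open.prod h₂open
  set w₁ : (Fin n → ℂ) → ℝ≥0∞ := fun z => expE (-(φ₁ z)) with hw₁def
  set w₂ : (Fin m → ℂ) → ℝ≥0∞ := fun z => expE (-(φ₂ z)) with hw₂def
  have hw₁ : AEMeasurable w₁ (volume.restrict D₁) := aux_weight h₁open hφ₁.1
  have hw₂ : AEMeasurable w₂ (volume.restrict D₂) := aux_weight h₂open hφ₂.1
  have hw₂0 : ∀ w ∈ D₂, w₂ w ≠ 0 := by
    intro w hw
    simp only [hw₂def, expE]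
    rw [Ne, EReal.exp_eq_zero_iff, EReal.neg_eq_bot_iff]
    exact (hφ₂top w hw).ne
  have hlow := aux_low h₁open hφ₁.1 hφ₁top
  have hvol : (volume : Measure ((Fin n → ℂ) × (Fin m → ℂ))).restrict (D₁ ×ˢ D₂) =
      (volume.restrict D₁).prod (volume.restrict D₂) := by
    rw [Measure.volume_eq_prod, ← Measure.prod_restrict]
  have hww : ∀ p ∈ D₁ ×ˢ D₂, expE (-(φ₁ p.1 + φ₂ p.2)) = w₁ p.1 * w₂ p.2 := fun p hp =>
    aux_exp_add (hφ₁top _ hp.1) (hφ₂top _ hp.2)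
  have hL : ∀ u : (Fin n → ℂ) × (Fin m → ℂ) → ℂ,
      ∫⁻ p in D₁ ×ˢ D₂, (‖u p‖₊ : ℝ≥0∞) ^ 2 * expE (-(φ₁ p.1 + φ₂ p.2)) =
      ∫⁻ p in D₁ ×ˢ D₂, ‖u p‖ₑ ^ 2 * (w₁ p.1 * w₂ p.2) := by
    intro u
    refine setLIntegral_congr_fun h12.measurableSet fun p hp => ?_
    simp only [hww p hp]
    rfl
  have hI : ∀ u v : (Fin n → ℂ) × (Fin m → ℂ) → ℂ,
      wInner (D₁ ×ˢ D₂) (fun w => φ₁ w.1 + φ₂ w.2) u v =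
      ∫ p in D₁ ×ˢ D₂, u p * (starRingEnd ℂ) (v p) * (((w₁ p.1 * w₂ p.2).toReal : ℝ) : ℂ) := by
    intro u v
    refine setIntegral_congr_fun h12.measurableSet fun p hp => ?_
    simp only [hww p hp]
  have hfm : ∀ i, AEStronglyMeasurable (f i) (volume.restrict D₁) := fun i =>
    (hf1 i).1.continuousOn.aestronglyMeasurable h₁open.measurableSet
  have hgm : ∀ j, AEStronglyMeasurable (g j) (volume.restrict D₂) := fun j =>
    (hg1 j).1.continuousOn.aestronglyMeasurable h₂open.measurableSet
  have hffin : ∀ i, ∫⁻ z in D₁, ‖f i z‖ₑ ^ 2 * w₁ z ≠ ⊤ := fun i => (hf1 i).2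
  have hgfin : ∀ j, ∫⁻ w in D₂, ‖g j w‖ₑ ^ 2 * w₂ w ≠ ⊤ := fun j => (hg1 j).2
  have hfgfin : ∀ i j, ∫⁻ p in D₁ ×ˢ D₂, ‖f i p.1 * g j p.2‖ₑ ^ 2 * (w₁ p.1 * w₂ p.2) ≠ ⊤ := by
    intro i j
    rw [hvol]
    have := lintegral_prod_mul (((hfm i).enorm.pow_const 2).mul hw₁)
      (((hgm j).enorm.pow_const 2).mul hw₂)
    simp only [Pi.mul_apply] at this
    have h2 := ENNReal.mul_ne_top (hffin i) (hgfin j)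
    rw [← this] at h2
    have h3 : ∀ p : (Fin n → ℂ) × (Fin m → ℂ), ‖f i p.1 * g j p.2‖ₑ ^ 2 * (w₁ p.1 * w₂ p.2) =
        ‖f i p.1‖ₑ ^ 2 * w₁ p.1 * (‖g j p.2‖ₑ ^ 2 * w₂ p.2) := by
      intro p
      rw [enorm_mul]; ring
    simp only [h3]
    exact h2
  have hfgd : ∀ i j, DifferentiableOn ℂ
      (fun w : (Fin n → ℂ) × (Fin m → ℂ) => f i w.1 * g j w.2) (D₁ ×ˢ D₂) := fun i j =>
    ((hf1 i).1.comp differentiableOn_fst (fun p hp => hp.1)).mul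
      ((hg1 j).1.comp differentiableOn_snd (fun p hp => hp.2))
  refine ⟨fun i j => ⟨hfgd i j, ?_⟩, ?_, ?_⟩
  · rw [hL]; exact hfgfin i j
  · intro i j i' j'
    rw [hI, hvol]
    have h1 := integral_prod_mul (μ := volume.restrict D₁) (ν := volume.restrict D₂)
      (fun z => f i z * (starRingEnd ℂ) (f i' z) * (((w₁ z).toReal : ℝ) : ℂ))
      (fun z => g j z * (starRingEnd ℂ) (g j' z) * (((w₂ z).toReal : ℝ) : ℂ))
    have e1 := hf2 i i'
    have e2 := hg2 j j'
    unfold wInner at e1 e2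
    rw [e1, e2] at h1
    have h3 : (if i = i' ∧ j = j' then (1:ℂ) else 0) =
        (if i = i' then 1 else 0) * (if j = j' then 1 else 0) := by
      split_ifs <;> simp_all
    rw [h3, ← h1]
    congr 1
    ext p
    rw [ENNReal.toReal_mul, map_mul, Complex.ofReal_mul]
    ring
  · intro h hh horth
    obtain ⟨hhd, hhfin⟩ := hh
    rw [hL] at hhfin
    have hhm : AEStronglyMeasurable h (volume.restrict (D₁ ×ˢ D₂)) :=
      hhd.continuousOn.aestronglyMeasurable h12.measurableSet
    have hw12 : AEMeasurable (fun p : (Fin n → ℂ) × (Fin m → ℂ) => w₁ p.1 * w₂ p.2)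
        (volume.restrict (D₁ ×ˢ D₂)) := by
      rw [hvol]; exact hw₁.comp_fst.mul hw₂.comp_snd
    have hslice : ∀ z ∈ D₁, DifferentiableOn ℂ (fun w => h (z, w)) D₂ := fun z hz =>
      hhd.comp (by fun_prop) (fun w hw => ⟨hz, hw⟩)
    have hslicefin : ∀ z ∈ D₁, ∫⁻ w in D₂, ‖h (z, w)‖ₑ ^ 2 * w₂ w ≠ ⊤ := by
      intro z hz
      obtain ⟨r, hr, hb, G, hG, hG2, hGb⟩ :=
        aux_local h₁open h₂open hhd hw₁ hw₂ hlow hhfin z hz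
      refine ne_top_of_le_ne_top hG2 (setLIntegral_mono' h₂open.measurableSet fun w hw => ?_)
      gcongr
      exact hGb w hw z (Metric.mem_ball_self (by positivity))
    -- the partial inner products vanish identically
    have hzero : ∀ j, ∀ z ∈ D₁,
        ∫ w in D₂, h (z, w) * (starRingEnd ℂ) (g j w) * (((w₂ w).toReal : ℝ) : ℂ) = 0 := by
      intro j
      refine hf3 (fun z => ∫ w in D₂, h (z, w) * (starRingEnd ℂ) (g j w) *
        (((w₂ w).toReal : ℝ) : ℂ)) ⟨?_, ?_⟩ ?_
      · exact aux_hol h₁open h₂open hhd hw₁ hw₂ hlow hhfin hw₂0 (hgm j) (hgfin j)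
      · have hmp : AEMeasurable (fun p : (Fin n → ℂ) × (Fin m → ℂ) =>
            ‖h p‖ₑ ^ 2 * (w₁ p.1 * w₂ p.2)) ((volume.restrict D₁).prod (volume.restrict D₂)) := by
          rw [← hvol]; exact (hhm.enorm.pow_const 2).mul hw12
        rw [hvol, lintegral_prod _ hmp] at hhfin
        refine ne_top_of_le_ne_top (ENNReal.mul_ne_top (hgfin j) hhfin) ?_
        rw [← lintegral_const_mul' _ _ (hgfin j)]
        refine setLIntegral_mono' h₁open.measurableSet fun z hz => ?_
        have hsm : AEStronglyMeasurable (fun w => h (z, w)) (volume.restrict D₂) :=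
          (hslice z hz).continuousOn.aestronglyMeasurable h₂open.measurableSet
        have hcs := aux_CS hsm (hgm j) hw₂
        calc _ ≤ ((∫⁻ w in D₂, ‖h (z, w)‖ₑ ^ 2 * w₂ w) * (∫⁻ w in D₂, ‖g j w‖ₑ ^ 2 * w₂ w))
              * w₁ z := by
              gcongr ?_ * _
              exact hcs
          _ = (∫⁻ w in D₂, ‖g j w‖ₑ ^ 2 * w₂ w) *
                ((∫⁻ w in D₂, ‖h (z, w)‖ₑ ^ 2 * w₂ w) * w₁ z) := by ring
          _ = _ := by
              rw [← lintegral_mul_const'' (f := fun w => ‖h (z, w)‖ₑ ^ 2 * w₂ w) _ ((hsm.enorm.pow_const 2).mul hw₂)]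
              congr 2
              ext w
              ring
      · intro i
        have hint := aux_integrable hhm
          ((hfgd i j).continuousOn.aestronglyMeasurable h12.measurableSet) hw12 hhfin (hfgfin i j)
        have h0 := horth i j
        rw [hI] at h0
        rw [hvol] at h0 hint
        rw [integral_prod _ hint] at h0
        unfold wInner
        rw [← h0]
        congr 1
        ext z
        rw [mul_assoc, ← integral_mul_const]
        congr 1
        ext w
        rw [ENNReal.toReal_mul, map_mul, Complex.ofReal_mul]
        simp only [hw₁def]
        ring
    rintro ⟨z, w⟩ ⟨hz, hw⟩
    exact hg3 (fun w => h (z, w)) ⟨hslice z hz, hslicefin z hz⟩ (fun j => hzero j z hz) w hw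
end
end
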